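/- arXiv:2407.09878 — 4 statements merged into one kernel-verified Lean document; each statement's English description precedes it below -/
import Mathlib

section
/- Let P and Q be integer polygons in ℝ². Then the random variable X_{P⊕Q} associated with the Minkowski sum P ⊕ Q = {p + q : p ∈ P, q ∈ Q} equals X_P + X_Q up to an additive constant: X_{P⊕Q}(X) − X_P(X) − X_Q(X) is almost surely constant, where the same uniform random point X ∈ [0,1]² is used for all three. -/
open MeasureTheory

noncomputable section

/-- The embedding of `ℤ²` into `ℝ²`. -/
def toR2 (m : ℤ × ℤ) : ℝ × ℝ := ((m.1 : ℝ), (m.2 : ℝ))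

/-- The cross product of two integer vectors. -/
def zcross (v w : ℤ × ℤ) : ℤ := v.1 * w.2 - v.2 * w.1

/-- `latCount C x = |(C + x) ∩ ℤ²|`, the number of lattice points in the translate `C + x`. -/
def latCount (C : Set (ℝ × ℝ)) (x : ℝ × ℝ) : ℕ :=
  Set.ncard {m : ℤ × ℤ | toR2 m - x ∈ C}

/-- The uniform distribution on the unit square `[0,1]²`. -/
def μunit : Measure (ℝ × ℝ) := volume.restrict (Set.Icc (0 : ℝ × ℝ) 1)

open scoped Pointwise

/-- The convex hull in `ℝ²` of a finite set of lattice points. -/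
def latHull (S : Finset (ℤ × ℤ)) : Set (ℝ × ℝ) := convexHull ℝ (toR2 '' (S : Set (ℤ × ℤ)))

/-- `A` and `B` are the left and right endpoints of the face of `S` on which `y - σ x` is
maximal. -/
structure IsUpperFace (S : Finset (ℤ × ℤ)) (σ : ℝ) (A B : ℤ × ℤ) : Prop where
  left_mem : A ∈ S
  right_mem : B ∈ S
  le : A.1 ≤ B.1
  eq : (A.2 : ℝ) - σ * A.1 = B.2 - σ * B.1
  max : ∀ C ∈ S, (C.2 : ℝ) - σ * C.1 ≤ A.2 - σ * A.1
  between : ∀ C ∈ S, (C.2 : ℝ) - σ * C.1 = A.2 - σ * A.1 → A.1 ≤ C.1 ∧ C.1 ≤ B.1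

/-- `[a, b]` is the range of first coordinates of `S`. -/
structure IsWidth (S : Finset (ℤ × ℤ)) (a b : ℤ) : Prop where
  exists_left : ∃ p ∈ S, p.1 = a
  exists_right : ∃ p ∈ S, p.1 = b
  bounds : ∀ p ∈ S, a ≤ p.1 ∧ p.1 ≤ b

/-- The contribution of the upper edge from `A` to `B`, of slope `σ`. -/
def edgeSum (σ : ℝ) (A B : ℤ × ℤ) (x : ℝ × ℝ) : ℤ :=
  ∑ k ∈ Finset.Ioc A.1 B.1, ⌊(A.2 : ℝ) + σ * (k - x.1 - A.1) + x.2⌋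

/-- The sum over the vertical lattice lines of the rounded heights of the upper boundary. -/
def topSum (S : Finset (ℤ × ℤ)) (a b : ℤ) (x : ℝ × ℝ) : ℤ :=
  ∑ k ∈ Finset.Ioc a b, ⌊sSup {y : ℝ | ((k : ℝ) - x.1, y) ∈ latHull S} + x.2⌋

/-- The reflection of `S` in the horizontal axis. -/
def reflect (S : Finset (ℤ × ℤ)) : Finset (ℤ × ℤ) := S.image fun p => (p.1, -p.2)

/-- The slopes of the lines through two points of `S`. -/
def slopes (S : Finset (ℤ × ℤ)) : Finset ℝ :=
  (S ×ˢ S).image fun p => ((p.2.2 : ℝ) - p.1.2) / ((p.2.1 : ℝ) - p.1.1)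

lemma exists_isWidth {S : Finset (ℤ × ℤ)} (hS : S.Nonempty) : ∃ a b, IsWidth S a b := by
  obtain ⟨p, hp, hpm⟩ := S.exists_min_image Prod.fst hS
  obtain ⟨q, hq, hqm⟩ := S.exists_max_image Prod.fst hS
  exact ⟨p.1, q.1, ⟨p, hp, rfl⟩, ⟨q, hq, rfl⟩, fun r hr => ⟨hpm r hr, hqm r hr⟩⟩

lemma exists_isUpperFace {S : Finset (ℤ × ℤ)} (hS : S.Nonempty) (σ : ℝ) :
    ∃ A B, IsUpperFace S σ A B := by
  classical
  obtain ⟨p, hp, hpm⟩ := S.exists_max_image (fun p => (p.2 : ℝ) - σ * p.1) hS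
  have hF : (S.filter fun q => (q.2 : ℝ) - σ * q.1 = p.2 - σ * p.1).Nonempty :=
    ⟨p, by simp [hp]⟩
  obtain ⟨A, hA, hAm⟩ := Finset.exists_min_image _ Prod.fst hF
  obtain ⟨B, hB, hBm⟩ := Finset.exists_max_image _ Prod.fst hF
  have hAB := hAm B hB
  simp only [Finset.mem_filter] at hA hB hAm hBm
  refine ⟨A, B, hA.1, hB.1, hAB, hA.2.trans hB.2.symm, fun C hC => ?_, fun C hC h => ?_⟩
  · rw [hA.2]
    exact hpm C hC
  · exact ⟨hAm C ⟨hC, h.trans hA.2⟩, hBm C ⟨hC, h.trans hA.2⟩⟩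

lemma IsUpperFace.add {S T : Finset (ℤ × ℤ)} {σ : ℝ} {A B A' B' : ℤ × ℤ}
    (h : IsUpperFace S σ A B) (h' : IsUpperFace T σ A' B') :
    IsUpperFace (S + T) σ (A + A') (B + B') := by
  refine ⟨Finset.add_mem_add h.left_mem h'.left_mem, Finset.add_mem_add h.right_mem h'.right_mem,
    add_le_add h.le h'.le, ?_, ?_, ?_⟩
  · have := h.eq
    have := h'.eq
    simp only [Prod.fst_add, Prod.snd_add]
    push_cast
    linarith
  · intro C hC
    obtain ⟨p, hp, q, hq, rfl⟩ := Finset.mem_add.1 hC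
    have := h.max p hp
    have := h'.max q hq
    simp only [Prod.fst_add, Prod.snd_add]
    push_cast
    linarith
  · intro C hC hC'
    obtain ⟨p, hp, q, hq, rfl⟩ := Finset.mem_add.1 hC
    have h1 := h.max p hp
    have h2 := h'.max q hq
    simp only [Prod.fst_add, Prod.snd_add] at hC' ⊢
    push_cast at hC'
    have h3 := h.between p hp (by linarith)
    have h4 := h'.between q hq (by linarith)
    omega

lemma IsUpperFace.le_of_lt {S : Finset (ℤ × ℤ)} {σ τ : ℝ} {A B A' B' : ℤ × ℤ}
    (h : IsUpperFace S σ A B) (h' : IsUpperFace S τ A' B') (hστ : σ < τ) : B'.1 ≤ A.1 := by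
  have h1 := h.max B' h'.right_mem
  have h2 := h'.max A h.left_mem
  have h3 := h'.eq
  have h4 : (τ - σ) * ((B'.1 : ℝ) - A.1) ≤ 0 := by linarith
  have h5 : (B'.1 : ℝ) - A.1 ≤ 0 := by
    by_contra! h6
    nlinarith [mul_pos (sub_pos.2 hστ) h6]
  exact_mod_cast sub_nonpos.1 h5

lemma latHull_subset {S : Finset (ℤ × ℤ)} {u v c : ℝ}
    (h : ∀ p ∈ S, u * p.1 + v * p.2 ≤ c) {z : ℝ × ℝ} (hz : z ∈ latHull S) :
    u * z.1 + v * z.2 ≤ c := by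
  have hconv : Convex ℝ {w : ℝ × ℝ | u * w.1 + v * w.2 ≤ c} := by
    refine convex_halfSpace_le (f := fun w : ℝ × ℝ => u * w.1 + v * w.2) ⟨?_, ?_⟩ c
    · intro w w'
      simp only [Prod.fst_add, Prod.snd_add]
      ring
    · intro r w
      simp only [Prod.smul_fst, Prod.smul_snd, smul_eq_mul]
      ring
  refine convexHull_min ?_ hconv hz
  rintro _ ⟨p, hp, rfl⟩
  exact h p hp

lemma toR2_mem_latHull {S : Finset (ℤ × ℤ)} {p : ℤ × ℤ} (hp : p ∈ S) : toR2 p ∈ latHull S :=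
  subset_convexHull ℝ _ ⟨p, hp, rfl⟩

lemma convex_latHull (S : Finset (ℤ × ℤ)) : Convex ℝ (latHull S) := convex_convexHull ℝ _

lemma IsUpperFace.isGreatest {S : Finset (ℤ × ℤ)} {σ s : ℝ} {A B : ℤ × ℤ}
    (h : IsUpperFace S σ A B) (hA : A.1 < s) (hB : s < B.1) :
    IsGreatest {y : ℝ | (s, y) ∈ latHull S} (A.2 + σ * (s - A.1)) := by
  constructor
  · have hd : (0 : ℝ) < B.1 - A.1 := by linarith
    have := convex_latHull S (toR2_mem_latHull h.left_mem) (toR2_mem_latHull h.right_mem)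
      (a := (B.1 - s) / (B.1 - A.1)) (b := (s - A.1) / (B.1 - A.1))
      (div_nonneg (by linarith) hd.le) (div_nonneg (by linarith) hd.le)
      (by field_simp; ring)
    have hy : (B.2 : ℝ) = A.2 + σ * (B.1 - A.1) := by linarith [h.eq]
    show (s, (A.2 : ℝ) + σ * (s - A.1)) ∈ latHull S
    convert this using 1
    ext
    · simp only [toR2, Prod.fst_add, Prod.smul_fst, smul_eq_mul]
      field_simp
      ring
    · simp only [toR2, Prod.snd_add, Prod.smul_snd, smul_eq_mul, hy]
      field_simp
      ring
  · intro y hy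
    have := latHull_subset (u := -σ) (v := 1) (c := A.2 - σ * A.1)
      (fun p hp => by linarith [h.max p hp]) hy
    simp only at this
    linarith

/-- Over every abscissa `s` inside the width of `S` that carries no point of `S` there is an
upper edge of `S`. -/
lemma exists_slope {S : Finset (ℤ × ℤ)} {a b : ℤ} (hab : IsWidth S a b) {s : ℝ}
    (has : a < s) (hsb : s < b) (hs : ∀ p ∈ S, (p.1 : ℝ) ≠ s) :
    ∃ σ ∈ slopes S, ∃ A ∈ S, ∃ B ∈ S, (A.1 : ℝ) < s ∧ s < B.1 ∧
      (A.2 : ℝ) - σ * A.1 = B.2 - σ * B.1 ∧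
      ∀ C ∈ S, (C.2 : ℝ) - σ * C.1 ≤ A.2 - σ * A.1 := by
  classical
  obtain ⟨p, hp, rfl⟩ := hab.exists_left
  obtain ⟨q, hq, rfl⟩ := hab.exists_right
  obtain ⟨⟨A, B⟩, hAB, hmax⟩ := Finset.exists_max_image
    ((S ×ˢ S).filter fun r => (r.1.1 : ℝ) < s ∧ s < r.2.1)
    (fun r => (r.1.2 : ℝ) + ((r.2.2 : ℝ) - r.1.2) / ((r.2.1 : ℝ) - r.1.1) * (s - r.1.1))
    ⟨(p, q), by simp [hp, hq, has, hsb]⟩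
  simp only [Finset.mem_filter, Finset.mem_product] at hAB hmax
  obtain ⟨⟨hA, hB⟩, hAs, hsB⟩ := hAB
  set σ := ((B.2 : ℝ) - A.2) / ((B.1 : ℝ) - A.1) with hσ
  have hd : (0 : ℝ) < B.1 - A.1 := by linarith
  have hslope : (A.2 : ℝ) - σ * A.1 = B.2 - σ * B.1 := by
    have : σ * ((B.1 : ℝ) - A.1) = B.2 - A.2 := div_mul_cancel₀ _ hd.ne'
    linarith
  refine ⟨σ, Finset.mem_image.2 ⟨(A, B), by simp [hA, hB], rfl⟩, A, hA, B, hB, hAs, hsB, hslope,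
    fun C hC => ?_⟩
  rcases lt_or_gt_of_ne (hs C hC) with hCs | hCs
  · have h1 := hmax (C, B) ⟨⟨hC, hB⟩, hCs, hsB⟩
    have hd' : (0 : ℝ) < B.1 - C.1 := by linarith
    simp only at h1
    set τ := ((B.2 : ℝ) - C.2) / ((B.1 : ℝ) - C.1) with hτ
    have h2 : τ * ((B.1 : ℝ) - C.1) = B.2 - C.2 := div_mul_cancel₀ _ hd'.ne'
    have h3 : (τ - σ) * ((B.1 : ℝ) - s) ≥ 0 := by linarith
    have h4 : 0 ≤ τ - σ := nonneg_of_mul_nonneg_left h3 (by linarith)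
    nlinarith [mul_nonneg h4 hd'.le]
  · have h1 := hmax (A, C) ⟨⟨hA, hC⟩, hAs, hCs⟩
    have hd' : (0 : ℝ) < C.1 - A.1 := by linarith
    simp only at h1
    set τ := ((C.2 : ℝ) - A.2) / ((C.1 : ℝ) - A.1) with hτ
    have h2 : τ * ((C.1 : ℝ) - A.1) = C.2 - A.2 := div_mul_cancel₀ _ hd'.ne'
    have h3 : (σ - τ) * (s - (A.1 : ℝ)) ≥ 0 := by linarith
    have h4 : 0 ≤ σ - τ := nonneg_of_mul_nonneg_left h3 (by linarith)
    nlinarith [mul_nonneg h4 hd'.le]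

lemma intCast_ne_sub {k m : ℤ} {t : ℝ} (h0 : 0 < t) (h1 : t < 1) : (m : ℝ) ≠ k - t := by
  intro h
  have h2 : m < k := by exact_mod_cast (by linarith : (m : ℝ) < k)
  have h3 : k < m + 1 := by exact_mod_cast (by push_cast; linarith : (k : ℝ) < (m + 1 : ℤ))
  omega

lemma intCast_lt_of_lt_sub {k m : ℤ} {t : ℝ} (h0 : 0 < t) (h : (m : ℝ) < k - t) : m < k := by
  exact_mod_cast (by linarith : (m : ℝ) < k)

lemma le_intCast_of_sub_lt {k m : ℤ} {t : ℝ} (h1 : t < 1) (h : (k : ℝ) - t < m) : k ≤ m := by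
  have : k < m + 1 := by exact_mod_cast (by push_cast; linarith : (k : ℝ) < (m + 1 : ℤ))
  omega

lemma sub_bounds_of_mem_Ioc {a b k : ℤ} {t : ℝ} (h0 : 0 < t) (h1 : t < 1)
    (hk : k ∈ Finset.Ioc a b) : (a : ℝ) < k - t ∧ (k : ℝ) - t < b := by
  rw [Finset.mem_Ioc] at hk
  have h2 : ((a + 1 : ℤ) : ℝ) ≤ k := by exact_mod_cast hk.1
  have h3 : (k : ℝ) ≤ b := by exact_mod_cast hk.2
  push_cast at h2
  constructor <;> linarith

/-- The upper boundary decomposes into the upper edges. -/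
lemma topSum_eq {S : Finset (ℤ × ℤ)} {a b : ℤ} (hab : IsWidth S a b) {L R : ℝ → ℤ × ℤ}
    (hLR : ∀ σ, IsUpperFace S σ (L σ) (R σ)) {D : Finset ℝ} (hD : slopes S ⊆ D) {x : ℝ × ℝ}
    (h0 : 0 < x.1) (h1 : x.1 < 1) :
    topSum S a b x = ∑ σ ∈ D, edgeSum σ (L σ) (R σ) x := by
  classical
  have hU : Finset.Ioc a b = D.biUnion fun σ => Finset.Ioc (L σ).1 (R σ).1 := by
    ext k
    simp only [Finset.mem_biUnion]
    constructor
    · intro hk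
      obtain ⟨ha, hb⟩ := sub_bounds_of_mem_Ioc h0 h1 hk
      obtain ⟨σ, hσ, A, hA, B, hB, hAs, hsB, heq, hmax⟩ :=
        exists_slope hab ha hb fun p _ => intCast_ne_sub h0 h1
      have hL := (hLR σ).max A hA
      have hL' := hmax _ (hLR σ).left_mem
      have h2 := (hLR σ).between A hA (le_antisymm hL hL')
      have h3 := (hLR σ).between B hB (by linarith)
      have h4 := intCast_lt_of_lt_sub h0 hAs
      have h5 := le_intCast_of_sub_lt h1 hsB
      exact ⟨σ, hD hσ, Finset.mem_Ioc.2 ⟨by omega, by omega⟩⟩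
    · rintro ⟨σ, -, hk⟩
      have h2 := hab.bounds _ (hLR σ).left_mem
      have h3 := hab.bounds _ (hLR σ).right_mem
      rw [Finset.mem_Ioc] at hk ⊢
      omega
  rw [topSum, hU, Finset.sum_biUnion]
  · refine Finset.sum_congr rfl fun σ _ => Finset.sum_congr rfl fun k hk => ?_
    obtain ⟨ha, hb⟩ := sub_bounds_of_mem_Ioc h0 h1 hk
    rw [((hLR σ).isGreatest ha hb).csSup_eq]
  · intro σ _ τ _ hne
    refine Finset.disjoint_left.2 fun k hk hk' => ?_
    rw [Finset.mem_Ioc] at hk hk'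
    rcases lt_or_gt_of_ne hne with h | h
    · have := (hLR σ).le_of_lt (hLR τ) h
      omega
    · have := (hLR τ).le_of_lt (hLR σ) h
      omega

lemma sum_Ioc_add (f : ℤ → ℤ) (a b c : ℤ) :
    ∑ k ∈ Finset.Ioc (a + c) (b + c), f k = ∑ k ∈ Finset.Ioc a b, f (k + c) := by
  rw [← Finset.map_add_right_Ioc, Finset.sum_map]
  rfl

lemma edgeSum_add {σ : ℝ} {A B A' B' : ℤ × ℤ} (hAB : A.1 ≤ B.1) (hAB' : A'.1 ≤ B'.1)
    (h : (A.2 : ℝ) - σ * A.1 = B.2 - σ * B.1) (x : ℝ × ℝ) :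
    edgeSum σ (A + A') (B + B') x = edgeSum σ A B x + edgeSum σ A' B' x +
      ((B.1 - A.1) * A'.2 + (B'.1 - A'.1) * B.2) := by
  have hsplit : Finset.Ioc (A.1 + A'.1) (B.1 + B'.1) =
      Finset.Ioc (A.1 + A'.1) (B.1 + A'.1) ∪ Finset.Ioc (A'.1 + B.1) (B'.1 + B.1) := by
    rw [add_comm A'.1, add_comm B'.1, Finset.Ioc_union_Ioc_eq_Ioc] <;> omega
  have hdisj : Disjoint (Finset.Ioc (A.1 + A'.1) (B.1 + A'.1))
      (Finset.Ioc (A'.1 + B.1) (B'.1 + B.1)) := by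
    refine Finset.disjoint_left.2 fun k hk hk' => ?_
    rw [Finset.mem_Ioc] at hk hk'
    omega
  have e1 : ∀ k : ℤ, ⌊(((A + A').2 : ℤ) : ℝ) + σ * (((k + A'.1 : ℤ) : ℝ) - x.1 -
      ((A + A').1 : ℤ)) + x.2⌋ = ⌊(A.2 : ℝ) + σ * (k - x.1 - A.1) + x.2⌋ + A'.2 := by
    intro k
    rw [← Int.floor_add_intCast, Prod.fst_add, Prod.snd_add]
    congr 1
    push_cast
    ring
  have e2 : ∀ k : ℤ, ⌊(((A + A').2 : ℤ) : ℝ) + σ * (((k + B.1 : ℤ) : ℝ) - x.1 -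
      ((A + A').1 : ℤ)) + x.2⌋ = ⌊(A'.2 : ℝ) + σ * (k - x.1 - A'.1) + x.2⌋ + B.2 := by
    intro k
    rw [← Int.floor_add_intCast, Prod.fst_add, Prod.snd_add]
    congr 1
    push_cast
    linarith
  have hc : ∀ {m n : ℤ}, m ≤ n → ((n - m).toNat : ℤ) = n - m := fun hmn =>
    Int.toNat_of_nonneg (by omega)
  simp only [edgeSum]
  rw [show (A + A').1 = A.1 + A'.1 from rfl, show (B + B').1 = B.1 + B'.1 from rfl, hsplit,
    Finset.sum_union hdisj, sum_Ioc_add, sum_Ioc_add]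
  rw [Prod.fst_add] at e1 e2
  simp only [e1, e2, Finset.sum_add_distrib, Finset.sum_const, Int.card_Ioc, nsmul_eq_mul,
    hc hAB, hc hAB']
  ring

lemma exists_topSum_add {S T : Finset (ℤ × ℤ)} {a b a' b' a'' b'' : ℤ} (hS : IsWidth S a b)
    (hT : IsWidth T a' b') (hST : IsWidth (S + T) a'' b'') :
    ∃ c : ℤ, ∀ x : ℝ × ℝ, 0 < x.1 → x.1 < 1 →
      topSum (S + T) a'' b'' x = topSum S a b x + topSum T a' b' x + c := by
  classical
  obtain ⟨p, hp, -⟩ := hS.exists_left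
  obtain ⟨q, hq, -⟩ := hT.exists_left
  choose L R hLR using exists_isUpperFace ⟨p, hp⟩
  choose L' R' hLR' using exists_isUpperFace ⟨q, hq⟩
  let D := slopes S ∪ slopes T ∪ slopes (S + T)
  refine ⟨∑ σ ∈ D, (((R σ).1 - (L σ).1) * (L' σ).2 + ((R' σ).1 - (L' σ).1) * (R σ).2),
    fun x h0 h1 => ?_⟩
  rw [topSum_eq (D := D) hS hLR (fun _ h => by simp [D, h]) h0 h1,
    topSum_eq (D := D) hT hLR' (fun _ h => by simp [D, h]) h0 h1,
    topSum_eq (D := D) hST (fun σ => (hLR σ).add (hLR' σ)) (fun _ h => by simp [D, h]) h0 h1,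
    ← Finset.sum_add_distrib, ← Finset.sum_add_distrib]
  exact Finset.sum_congr rfl fun σ _ => edgeSum_add (hLR σ).le (hLR' σ).le (hLR σ).eq x

lemma IsWidth.reflect {S : Finset (ℤ × ℤ)} {a b : ℤ} (h : IsWidth S a b) :
    IsWidth (reflect S) a b := by
  obtain ⟨p, hp, hpa⟩ := h.exists_left
  obtain ⟨q, hq, hqb⟩ := h.exists_right
  refine ⟨⟨_, Finset.mem_image_of_mem _ hp, hpa⟩, ⟨_, Finset.mem_image_of_mem _ hq, hqb⟩, ?_⟩
  intro r hr
  obtain ⟨t, ht, rfl⟩ := Finset.mem_image.1 hr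
  exact h.bounds t ht

lemma reflect_add (S T : Finset (ℤ × ℤ)) : reflect (S + T) = reflect S + reflect T := by
  refine Finset.image_image₂_distrib fun p q => ?_
  ext <;> simp [add_comm]

lemma mem_latHull_reflect {S : Finset (ℤ × ℤ)} {s y : ℝ} :
    (s, y) ∈ latHull (reflect S) ↔ (s, -y) ∈ latHull S := by
  let f : ℝ × ℝ →ₗ[ℝ] ℝ × ℝ := LinearMap.id.prodMap (-LinearMap.id)
  have hf : latHull (reflect S) = f '' latHull S := by
    rw [latHull, latHull, f.image_convexHull, reflect, Finset.coe_image, Set.image_image,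
      Set.image_image]
    congr 1
    refine Set.image_congr fun p _ => ?_
    simp [f, toR2]
  rw [hf]
  constructor
  · rintro ⟨⟨u, v⟩, h, he⟩
    simp only [f, LinearMap.prodMap_apply, LinearMap.id_apply, LinearMap.neg_apply,
      Prod.mk.injEq] at he
    obtain ⟨rfl, rfl⟩ := he
    simpa using h
  · intro h
    exact ⟨_, h, by simp [f]⟩

lemma exists_isGreatest {S : Finset (ℤ × ℤ)} {a b : ℤ} (hab : IsWidth S a b) {s : ℝ}
    (has : a < s) (hsb : s < b) (hs : ∀ m : ℤ, (m : ℝ) ≠ s) :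
    ∃ y, IsGreatest {y : ℝ | (s, y) ∈ latHull S} y := by
  obtain ⟨σ, -, A, hA, B, hB, hAs, hsB, heq, hmax⟩ := exists_slope hab has hsb fun p _ => hs p.1
  obtain ⟨L, R, h⟩ := exists_isUpperFace ⟨A, hA⟩ σ
  have hL := le_antisymm (h.max A hA) (hmax L h.left_mem)
  have h2 := (h.between A hA hL).1
  have h3 := (h.between B hB (by linarith)).2
  exact ⟨_, h.isGreatest (lt_of_le_of_lt (by exact_mod_cast h2) hAs)
    (lt_of_lt_of_le hsB (by exact_mod_cast h3))⟩

lemma latCount_latHull {S : Finset (ℤ × ℤ)} {a b : ℤ} (hab : IsWidth S a b) {x : ℝ × ℝ}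
    (h0 : 0 < x.1) (h1 : x.1 < 1) :
    (latCount (latHull S) x : ℤ) =
      topSum S a b x + topSum (reflect S) a b (x.1, -x.2) + (Finset.Ioc a b).card := by
  classical
  have hu : ∀ k ∈ Finset.Ioc a b, IsGreatest {y : ℝ | ((k : ℝ) - x.1, y) ∈ latHull S}
      (sSup {y : ℝ | ((k : ℝ) - x.1, y) ∈ latHull S}) := by
    intro k hk
    obtain ⟨ha, hb⟩ := sub_bounds_of_mem_Ioc h0 h1 hk
    obtain ⟨y, hy⟩ := exists_isGreatest hab ha hb fun m => intCast_ne_sub h0 h1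
    rwa [hy.csSup_eq]
  have hl : ∀ k ∈ Finset.Ioc a b, IsGreatest {y : ℝ | ((k : ℝ) - x.1, y) ∈ latHull (reflect S)}
      (sSup {y : ℝ | ((k : ℝ) - x.1, y) ∈ latHull (reflect S)}) := by
    intro k hk
    obtain ⟨ha, hb⟩ := sub_bounds_of_mem_Ioc h0 h1 hk
    obtain ⟨y, hy⟩ := exists_isGreatest hab.reflect ha hb fun m => intCast_ne_sub h0 h1
    rwa [hy.csSup_eq]
  simp only [topSum]
  set u : ℤ → ℝ := fun k => sSup {y : ℝ | ((k : ℝ) - x.1, y) ∈ latHull S}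
  set v : ℤ → ℝ := fun k => sSup {y : ℝ | ((k : ℝ) - x.1, y) ∈ latHull (reflect S)}
  change ∀ k ∈ Finset.Ioc a b, IsGreatest _ (u k) at hu
  change ∀ k ∈ Finset.Ioc a b, IsGreatest _ (v k) at hl
  have hmem : ∀ k ∈ Finset.Ioc a b, ∀ y : ℝ,
      ((k : ℝ) - x.1, y) ∈ latHull S ↔ -v k ≤ y ∧ y ≤ u k := by
    intro k hk y
    have hlow : ((k : ℝ) - x.1, -v k) ∈ latHull S := mem_latHull_reflect.1 (hl k hk).1
    constructor
    · intro h
      have : ((k : ℝ) - x.1, -y) ∈ latHull (reflect S) :=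
        mem_latHull_reflect.2 (by rwa [neg_neg])
      exact ⟨by linarith [(hl k hk).2 this], (hu k hk).2 h⟩
    · intro h
      have hc : Convex ℝ {y : ℝ | ((k : ℝ) - x.1, y) ∈ latHull S} := by
        intro y hy z hz p q hp hq hpq
        have := convex_latHull S hy hz hp hq hpq
        rwa [Prod.smul_mk, Prod.smul_mk, Prod.mk_add_mk, Convex.combo_self hpq] at this
      exact hc.ordConnected.out hlow (hu k hk).1 h
  have hset : {m : ℤ × ℤ | toR2 m - x ∈ latHull S} =
      (((Finset.Ioc a b).sigma fun k => Finset.Icc ⌈-v k + x.2⌉ ⌊u k + x.2⌋).map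
        (Equiv.sigmaEquivProd ℤ ℤ).toEmbedding : Finset (ℤ × ℤ)) := by
    ext ⟨k, m⟩
    have hkm : toR2 (k, m) - x = ((k : ℝ) - x.1, (m : ℝ) - x.2) := rfl
    have hk : toR2 (k, m) - x ∈ latHull S → k ∈ Finset.Ioc a b := by
      intro h
      have h2 := latHull_subset (u := 1) (v := 0) (c := b)
        (fun p hp => by have := (hab.bounds p hp).2; simpa using this) h
      have h3 := latHull_subset (u := -1) (v := 0) (c := -a)
        (fun p hp => by have := (hab.bounds p hp).1; simpa using this) h
      simp only [hkm] at h2 h3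
      have h4 : ((a : ℤ) : ℝ) < k := by linarith
      have h5 : (k : ℝ) - x.1 < b :=
        lt_of_le_of_ne (by linarith) (intCast_ne_sub h0 h1).symm
      exact Finset.mem_Ioc.2 ⟨by exact_mod_cast h4, le_intCast_of_sub_lt h1 h5⟩
    have hmap : (k, m) ∈ (((Finset.Ioc a b).sigma fun k =>
        Finset.Icc ⌈-v k + x.2⌉ ⌊u k + x.2⌋).map (Equiv.sigmaEquivProd ℤ ℤ).toEmbedding :
        Finset (ℤ × ℤ)) ↔ k ∈ Finset.Ioc a b ∧ m ∈ Finset.Icc ⌈-v k + x.2⌉ ⌊u k + x.2⌋ := by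
      rw [Finset.mem_map_equiv, Finset.mem_sigma]
      rfl
    rw [Finset.mem_coe, hmap, Set.mem_ofPred_eq, Finset.mem_Icc, Int.ceil_le, Int.le_floor]
    constructor
    · intro h
      have := (hmem k (hk h) _).1 (hkm ▸ h)
      exact ⟨hk h, by linarith, by linarith⟩
    · rintro ⟨h, h2, h3⟩
      rw [hkm]
      exact (hmem k h _).2 ⟨by linarith, by linarith⟩
  rw [latCount, hset, Set.ncard_coe_finset, Finset.card_map, Finset.card_sigma, Nat.cast_sum,
    Finset.card_eq_sum_ones, Nat.cast_sum, ← Finset.sum_add_distrib, ← Finset.sum_add_distrib]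
  refine Finset.sum_congr rfl fun k hk => ?_
  have hvu : -v k ≤ u k := ((hmem k hk _).1 (hu k hk).1).1
  have hceil : ⌈-v k + x.2⌉ = -⌊v k + -x.2⌋ := by
    rw [← Int.ceil_neg]
    congr 1
    ring
  have hle : ⌈-v k + x.2⌉ ≤ ⌊u k + x.2⌋ + 1 :=
    (Int.ceil_le_ceil (by linarith)).trans (Int.ceil_le_floor_add_one _)
  rw [Int.card_Icc, Int.toNat_of_nonneg (by omega), hceil]
  push_cast
  ring

lemma latHull_add (S T : Finset (ℤ × ℤ)) : latHull (S + T) = latHull S + latHull T := by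
  rw [latHull, latHull, latHull, ← convexHull_add, Finset.coe_add]
  congr 1
  refine Set.image_image2_distrib fun p q => ?_
  ext <;> simp [toR2]

lemma ae_fst_mem_Ioo : ∀ᵐ x ∂μunit, 0 < x.1 ∧ x.1 < 1 := by
  have hne : ∀ c : ℝ, ∀ᵐ x : ℝ × ℝ, x.1 ≠ c := fun c =>
    Measure.quasiMeasurePreserving_fst.ae (Measure.ae_ne volume c)
  filter_upwards [ae_restrict_mem (μ := volume) (measurableSet_Icc (a := (0 : ℝ × ℝ)) (b := 1)),
    ae_restrict_of_ae (hne 0), ae_restrict_of_ae (hne 1)] with x hx hx0 hx1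
  exact ⟨lt_of_le_of_ne hx.1.1 hx0.symm, lt_of_le_of_ne hx.2.1 hx1⟩

/-- For integer polygons `P` and `Q`, the random variable `X_{P⊕Q}`
associated with the Minkowski sum `P ⊕ Q = {p + q : p ∈ P, q ∈ Q}` equals `X_P + X_Q` up to
an additive constant, almost surely, with the same uniform point `X ∈ [0,1]²` used
for all three. -/
theorem latCount_minkowski_sum (n₁ n₂ : ℕ)
    (a : Fin (n₁ + 3) → ℤ × ℤ) (b : Fin (n₂ + 3) → ℤ × ℤ)
    (hccwa : ∀ i : Fin (n₁ + 3), 0 < zcross (a (i + 1) - a i) (a (i + 2) - a (i + 1)))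
    (hccwb : ∀ i : Fin (n₂ + 3), 0 < zcross (b (i + 1) - b i) (b (i + 2) - b (i + 1)))
    (P Q : Set (ℝ × ℝ))
    (hP : P = convexHull ℝ (Set.range fun i => toR2 (a i)))
    (hQ : Q = convexHull ℝ (Set.range fun i => toR2 (b i))) :
    ∃ c : ℤ, ∀ᵐ x ∂μunit,
      (latCount {y | ∃ p ∈ P, ∃ q ∈ Q, y = p + q} x : ℤ)
        = (latCount P x : ℤ) + (latCount Q x : ℤ) + c := by
  classical
  set S := Finset.univ.image a
  set T := Finset.univ.image b
  have hPS : P = latHull S := by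
    rw [hP, latHull, Finset.coe_image, Finset.coe_univ, Set.image_univ, ← Set.range_comp]
    rfl
  have hQT : Q = latHull T := by
    rw [hQ, latHull, Finset.coe_image, Finset.coe_univ, Set.image_univ, ← Set.range_comp]
    rfl
  have hPQ : {y | ∃ p ∈ P, ∃ q ∈ Q, y = p + q} = latHull (S + T) := by
    rw [latHull_add, hPS, hQT]
    ext y
    simp only [Set.mem_ofPred_eq, Set.mem_add, eq_comm]
  have hSne : S.Nonempty := Finset.univ_nonempty.image a
  have hTne : T.Nonempty := Finset.univ_nonempty.image b
  obtain ⟨l, r, hS⟩ := exists_isWidth hSne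
  obtain ⟨l', r', hT⟩ := exists_isWidth hTne
  obtain ⟨l'', r'', hST⟩ := exists_isWidth (hSne.add hTne)
  obtain ⟨c, hc⟩ := exists_topSum_add hS hT hST
  obtain ⟨d, hd⟩ := exists_topSum_add hS.reflect hT.reflect (reflect_add S T ▸ hST.reflect)
  refine ⟨c + d + (Finset.Ioc l'' r'').card - (Finset.Ioc l r).card - (Finset.Ioc l' r').card, ?_⟩
  filter_upwards [ae_fst_mem_Ioo] with x hx
  rw [hPQ, hPS, hQT, latCount_latHull hS hx.1 hx.2, latCount_latHull hT hx.1 hx.2,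
    latCount_latHull hST hx.1 hx.2, reflect_add, hc x hx.1 hx.2, hd (x.1, -x.2) hx.1 hx.2]
  ring
end
end

section
/- Let P ⊂ ℝ² be a centrally symmetric integer polygon. Then X_P is almost surely constant, equal to the area of P. -/
open MeasureTheory

noncomputable section

/-- The cross product of two real vectors. -/
def rcross (v w : ℝ × ℝ) : ℝ := v.1 * w.2 - v.2 * w.1

/-- The number of lattice points in the translate `A + x`, as an extended nonnegative real. -/
def latSum (A : Set (ℝ × ℝ)) (x : ℝ × ℝ) : ENNReal :=
  ∑' m : ℤ × ℤ, A.indicator 1 (toR2 m - x)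

/-- The numbers of lattice points in `A + x` and `A - x` almost surely have a constant sum. -/
def HasConstSymmSum (A : Set (ℝ × ℝ)) : Prop :=
  ∃ c : ENNReal, ∀ᵐ x : ℝ × ℝ, latSum A x + latSum A (-x) = c

theorem toR2_add (m k : ℤ × ℤ) : toR2 (m + k) = toR2 m + toR2 k := by
  ext <;> simp [toR2]

theorem toR2_sub (m k : ℤ × ℤ) : toR2 (m - k) = toR2 m - toR2 k := by
  ext <;> simp [toR2]

theorem latSum_eq_encard (A : Set (ℝ × ℝ)) (x : ℝ × ℝ) :
    latSum A x = {m : ℤ × ℤ | toR2 m - x ∈ A}.encard := by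
  rw [← ENNReal.tsum_set_one, tsum_subtype _ (fun _ => (1 : ENNReal))]
  rfl

theorem latSum_neg (A : Set (ℝ × ℝ)) (k : ℤ × ℤ) (x : ℝ × ℝ) :
    latSum A (-x) = ∑' m : ℤ × ℤ, A.indicator 1 (toR2 k - (toR2 m - x)) := by
  rw [latSum, ← (Equiv.subLeft k).tsum_eq]
  refine tsum_congr fun m => ?_
  rw [Equiv.subLeft_apply, toR2_sub]
  congr 1
  abel

theorem volume_line_eq_zero {u : ℝ × ℝ} (hu : u ≠ 0) (c : ℝ) :
    volume {y : ℝ × ℝ | rcross u y = c} = 0 := by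
  let L : AffineSubspace ℝ (ℝ × ℝ) :=
    { carrier := {y : ℝ × ℝ | rcross u y = c}
      smul_vsub_vadd_mem' := by
        intro t p q r hp hq hr
        simp only [rcross, Set.mem_ofPred_eq, vsub_eq_sub, vadd_eq_add, Prod.fst_add, Prod.snd_add,
          Prod.smul_fst, Prod.smul_snd, Prod.fst_sub, Prod.snd_sub, smul_eq_mul] at *
        linear_combination t * hp - t * hq + hr }
  refine Measure.addHaar_affineSubspace volume L fun h => hu ?_
  have key : ∀ y : ℝ × ℝ, rcross u y = c := fun y => by
    have : y ∈ L := h ▸ AffineSubspace.mem_top ℝ _ y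
    exact this
  have h0 := key 0
  have h1 := key (1, 0)
  have h2 := key (0, 1)
  simp only [rcross, Prod.fst_zero, Prod.snd_zero, mul_zero, sub_zero, mul_one, zero_sub] at h0 h1 h2
  ext <;> simp <;> linarith

theorem ae_latSum_of_ae {p : ℝ × ℝ → Prop} (h : ∀ᵐ y, p y) :
    ∀ᵐ x : ℝ × ℝ, ∀ m : ℤ × ℤ, p (toR2 m - x) :=
  ae_all_iff.2 fun m => (quasiMeasurePreserving_sub_left volume (toR2 m)).ae h

theorem ae_neg_of_ae {p : ℝ × ℝ → Prop} (h : ∀ᵐ y, p y) : ∀ᵐ y : ℝ × ℝ, p (-y) :=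
  (Measure.measurePreserving_neg (volume : Measure (ℝ × ℝ))).quasiMeasurePreserving.ae h

theorem hasConstSymmSum_of_null {A : Set (ℝ × ℝ)} (hA : volume A = 0) : HasConstSymmSum A := by
  have h : ∀ᵐ x : ℝ × ℝ, latSum A x = 0 := by
    filter_upwards [ae_latSum_of_ae (measure_eq_zero_iff_ae_notMem.1 hA)] with x hx
    simp [latSum, hx]
  refine ⟨0, ?_⟩
  filter_upwards [h, ae_neg_of_ae h] with x h1 h2
  rw [h1, h2, add_zero]

theorem HasConstSymmSum.union {A B : Set (ℝ × ℝ)} (hA : HasConstSymmSum A)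
    (hB : HasConstSymmSum B) (hAB : volume (A ∩ B) = 0) : HasConstSymmSum (A ∪ B) := by
  obtain ⟨a, ha⟩ := hA
  obtain ⟨b, hb⟩ := hB
  have h : ∀ᵐ x : ℝ × ℝ, latSum (A ∪ B) x = latSum A x + latSum B x := by
    filter_upwards [ae_latSum_of_ae (measure_eq_zero_iff_ae_notMem.1 hAB)] with x hx
    rw [latSum, latSum, latSum, ← ENNReal.tsum_add]
    refine tsum_congr fun m => ?_
    rw [Set.indicator_union_of_notMem_inter (hx m)]
  refine ⟨a + b, ?_⟩
  filter_upwards [ha, hb, h, ae_neg_of_ae h] with x h1 h2 h3 h4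
  rw [h3, h4, ← h1, ← h2, add_add_add_comm]

/-- A half-open parallelogram with integer edge vectors is a fundamental domain of the lattice
spanned by its edges, so it contains a fixed number of points of `ℤ²`. -/
theorem latSum_parallelogram (p v w : ℤ × ℤ) (hd : rcross (toR2 v) (toR2 w) ≠ 0) (x : ℝ × ℝ) :
    latSum {y | (rcross (y - toR2 p) (toR2 w) / rcross (toR2 v) (toR2 w)) ∈ Set.Ico (0 : ℝ) 1 ∧
      (rcross (toR2 v) (y - toR2 p) / rcross (toR2 v) (toR2 w)) ∈ Set.Ico (0 : ℝ) 1} x =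
    ENat.card ((ℤ × ℤ) ⧸ AddSubgroup.closure {v, w}) := by
  set d := rcross (toR2 v) (toR2 w) with hdd
  have hα : ∀ (y : ℝ × ℝ) (i j : ℤ), rcross (toR2 (i • v + j • w) + y) (toR2 w) / d =
      i + rcross y (toR2 w) / d := fun y i j => by
    field_simp
    simp only [hdd, rcross, toR2, Prod.fst_add, Prod.snd_add, Prod.smul_fst, Prod.smul_snd,
      smul_eq_mul, Int.cast_add, Int.cast_mul]
    ring
  have hβ : ∀ (y : ℝ × ℝ) (i j : ℤ), rcross (toR2 v) (toR2 (i • v + j • w) + y) / d =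
      j + rcross (toR2 v) y / d := fun y i j => by
    field_simp
    simp only [hdd, rcross, toR2, Prod.fst_add, Prod.snd_add, Prod.smul_fst, Prod.smul_snd,
      smul_eq_mul, Int.cast_add, Int.cast_mul]
    ring
  rw [latSum_eq_encard, Set.encard]
  congr 1
  refine ENat.card_congr (Equiv.ofBijective (fun m => QuotientAddGroup.mk m.1) ⟨?_, ?_⟩)
  · rintro ⟨m, hm⟩ ⟨k, hk⟩ h
    obtain ⟨i, j, hij⟩ := AddSubgroup.mem_closure_pair.1 (QuotientAddGroup.eq.1 h)
    have hk' : k = (i • v + j • w) + m := by rw [hij]; abel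
    have e : toR2 k - x - toR2 p = toR2 (i • v + j • w) + (toR2 m - x - toR2 p) := by
      rw [hk', toR2_add]; abel
    simp only [Set.mem_ofPred_eq, Set.mem_Ico, e, hα, hβ] at hm hk
    have hi : i = 0 := by
      have h1 : (-1 : ℝ) < i := by linarith
      have h2 : (i : ℝ) < 1 := by linarith
      have h3 : -1 < i := by exact_mod_cast h1
      have h4 : i < 1 := by exact_mod_cast h2
      omega
    have hj : j = 0 := by
      have h1 : (-1 : ℝ) < j := by linarith
      have h2 : (j : ℝ) < 1 := by linarith
      have h3 : -1 < j := by exact_mod_cast h1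
      have h4 : j < 1 := by exact_mod_cast h2
      omega
    simp [hk', hi, hj]
  · intro c
    obtain ⟨m, rfl⟩ := QuotientAddGroup.mk_surjective c
    set i := ⌊rcross (toR2 m - x - toR2 p) (toR2 w) / d⌋ with hi
    set j := ⌊rcross (toR2 v) (toR2 m - x - toR2 p) / d⌋ with hj
    have e : toR2 (((-i) • v + (-j) • w) + m) - x - toR2 p =
        toR2 ((-i) • v + (-j) • w) + (toR2 m - x - toR2 p) := by
      rw [toR2_add]; abel
    refine ⟨⟨((-i) • v + (-j) • w) + m, ?_⟩, ?_⟩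
    · simp only [Set.mem_ofPred_eq, Set.mem_Ico, e, hα, hβ, Int.cast_neg]
      have h1 := Int.floor_le (rcross (toR2 m - x - toR2 p) (toR2 w) / d)
      have h2 := Int.lt_floor_add_one (rcross (toR2 m - x - toR2 p) (toR2 w) / d)
      have h3 := Int.floor_le (rcross (toR2 v) (toR2 m - x - toR2 p) / d)
      have h4 := Int.lt_floor_add_one (rcross (toR2 v) (toR2 m - x - toR2 p) / d)
      rw [← hi] at h1 h2
      rw [← hj] at h3 h4
      refine ⟨⟨?_, ?_⟩, ?_, ?_⟩ <;> linarith
    · refine QuotientAddGroup.eq.2 (AddSubgroup.mem_closure_pair.2 ⟨i, j, ?_⟩)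
      simp only [neg_smul]
      abel

theorem convexHull_triangle (p q r : ℝ × ℝ) (hd : rcross (q - p) (r - p) ≠ 0) :
    convexHull ℝ {p, q, r} = {y | 0 ≤ rcross (y - p) (r - p) / rcross (q - p) (r - p) ∧
      0 ≤ rcross (q - p) (y - p) / rcross (q - p) (r - p) ∧
      rcross (y - p) (r - p) / rcross (q - p) (r - p) +
        rcross (q - p) (y - p) / rcross (q - p) (r - p) ≤ 1} := by
  set d := rcross (q - p) (r - p) with hdd
  have hα : ∀ (y z : ℝ × ℝ) (s t : ℝ), s + t = 1 → rcross (s • y + t • z - p) (r - p) / d =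
      s * (rcross (y - p) (r - p) / d) + t * (rcross (z - p) (r - p) / d) := by
    intro y z s t hst
    obtain rfl : t = 1 - s := by linarith
    field_simp
    simp only [rcross, Prod.fst_add, Prod.snd_add, Prod.smul_fst, Prod.smul_snd,
      smul_eq_mul, Prod.fst_sub, Prod.snd_sub]
    ring
  have hβ : ∀ (y z : ℝ × ℝ) (s t : ℝ), s + t = 1 → rcross (q - p) (s • y + t • z - p) / d =
      s * (rcross (q - p) (y - p) / d) + t * (rcross (q - p) (z - p) / d) := by
    intro y z s t hst
    obtain rfl : t = 1 - s := by linarith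
    field_simp
    simp only [rcross, Prod.fst_add, Prod.snd_add, Prod.smul_fst, Prod.smul_snd,
      smul_eq_mul, Prod.fst_sub, Prod.snd_sub]
    ring
  refine Set.Subset.antisymm (convexHull_min ?_ ?_) ?_
  · rintro y (rfl | rfl | rfl)
    · simp [rcross]
    · have h0 : rcross (y - p) (y - p) = 0 := by simp only [rcross]; ring
      simp [← hdd, h0, hd]
    · have h0 : rcross (y - p) (y - p) = 0 := by simp only [rcross]; ring
      simp [← hdd, h0, hd]
  · rintro y ⟨h1, h2, h3⟩ z ⟨h4, h5, h6⟩ s t hs ht hst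
    simp only [Set.mem_ofPred_eq, hα y z s t hst, hβ y z s t hst]
    refine ⟨by positivity, by positivity, ?_⟩
    nlinarith
  · rintro y ⟨h1, h2, h3⟩
    set a := rcross (y - p) (r - p) / d with ha
    set b := rcross (q - p) (y - p) / d with hb
    have hy : y = (1 - a - b) • p + a • q + b • r := by
      have hdx : d = (q.1 - p.1) * (r.2 - p.2) - (q.2 - p.2) * (r.1 - p.1) := rfl
      have hax : a * d = (y.1 - p.1) * (r.2 - p.2) - (y.2 - p.2) * (r.1 - p.1) :=
        div_mul_cancel₀ _ hd
      have hbx : b * d = (q.1 - p.1) * (y.2 - p.2) - (q.2 - p.2) * (y.1 - p.1) :=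
        div_mul_cancel₀ _ hd
      ext <;> refine mul_left_cancel₀ hd ?_
      · simp only [Prod.fst_add, Prod.smul_fst, smul_eq_mul]
        linear_combination (y.1 - p.1) * hdx - (q.1 - p.1) * hax - (r.1 - p.1) * hbx
      · simp only [Prod.snd_add, Prod.smul_snd, smul_eq_mul]
        linear_combination (y.2 - p.2) * hdx - (q.2 - p.2) * hax - (r.2 - p.2) * hbx
    rw [convexHull_insert (by simp), convexHull_pair, mem_convexJoin]
    rcases eq_or_ne (a + b) 0 with h0 | h0
    · have ha0 : a = 0 := by linarith
      have hb0 : b = 0 := by linarith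
      refine ⟨p, rfl, q, left_mem_segment ℝ q r, ?_⟩
      rw [hy, ha0, hb0]
      simpa using left_mem_segment ℝ p q
    · have hab : 0 < a + b := lt_of_le_of_ne (by linarith) h0.symm
      refine ⟨p, rfl, (a / (a + b)) • q + (b / (a + b)) • r,
        ⟨_, _, by positivity, by positivity, by field_simp, rfl⟩,
        1 - a - b, a + b, by linarith, by linarith, by ring, ?_⟩
      rw [hy, smul_add, smul_smul, smul_smul, mul_div_cancel₀ _ h0, mul_div_cancel₀ _ h0, add_assoc]

theorem hasConstSymmSum_triangle (p q r : ℤ × ℤ)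
    (hd : rcross (toR2 q - toR2 p) (toR2 r - toR2 p) ≠ 0) :
    HasConstSymmSum (convexHull ℝ {toR2 p, toR2 q, toR2 r}) := by
  have hd' := hd
  rw [← toR2_sub, ← toR2_sub] at hd'
  refine ⟨ENat.card ((ℤ × ℤ) ⧸ AddSubgroup.closure {q - p, r - p}), ?_⟩
  set d := rcross (toR2 q - toR2 p) (toR2 r - toR2 p) with hdd
  set α : ℝ × ℝ → ℝ := fun y => rcross (y - toR2 p) (toR2 r - toR2 p) / d with hα
  set β : ℝ × ℝ → ℝ := fun y => rcross (toR2 q - toR2 p) (y - toR2 p) / d with hβ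
  have hαr : ∀ y, α (toR2 (q + r) - y) = 1 - α y := fun y => by
    simp only [hα]
    field_simp
    simp only [hdd, rcross, toR2_add, Prod.fst_add, Prod.snd_add, Prod.fst_sub, Prod.snd_sub]
    ring
  have hβr : ∀ y, β (toR2 (q + r) - y) = 1 - β y := fun y => by
    simp only [hβ]
    field_simp
    simp only [hdd, rcross, toR2_add, Prod.fst_add, Prod.snd_add, Prod.fst_sub, Prod.snd_sub]
    ring
  have hq : toR2 q - toR2 p ≠ 0 := fun h => hd (by simp [hdd, h, rcross])
  have hr : toR2 r - toR2 p ≠ 0 := fun h => hd (by simp [hdd, h, rcross])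
  have hqr : toR2 q - toR2 r ≠ 0 := fun h => hd (by
    simp only [hdd, sub_eq_zero.1 h, rcross]; ring)
  have n1 : ∀ᵐ y, α y ≠ 1 := by
    refine measure_mono_null (fun y hy => ?_) (volume_line_eq_zero hr
      (rcross (toR2 r - toR2 p) (toR2 p) - d))
    have h : α y = 1 := not_not.1 hy
    simp only [hα, div_eq_iff hd, one_mul] at h
    simp only [rcross, Set.mem_ofPred_eq, Prod.fst_sub, Prod.snd_sub] at h ⊢
    linarith
  have n2 : ∀ᵐ y, β y ≠ 1 := by
    refine measure_mono_null (fun y hy => ?_) (volume_line_eq_zero hq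
      (rcross (toR2 q - toR2 p) (toR2 p) + d))
    have h : β y = 1 := not_not.1 hy
    simp only [hβ, div_eq_iff hd, one_mul] at h
    simp only [rcross, Set.mem_ofPred_eq, Prod.fst_sub, Prod.snd_sub] at h ⊢
    linarith
  have n3 : ∀ᵐ y, α y + β y ≠ 1 := by
    refine measure_mono_null (fun y hy => ?_) (volume_line_eq_zero hqr
      (rcross (toR2 q - toR2 r) (toR2 p) + d))
    have h : α y + β y = 1 := not_not.1 hy
    simp only [hα, hβ, ← add_div, div_eq_iff hd, one_mul] at h
    simp only [rcross, Set.mem_ofPred_eq, Prod.fst_sub, Prod.snd_sub] at h ⊢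
    linarith
  filter_upwards [ae_latSum_of_ae n1, ae_latSum_of_ae n2, ae_latSum_of_ae n3] with x h1 h2 h3
  rw [← latSum_parallelogram p _ _ hd' x, latSum_neg _ (q + r), convexHull_triangle _ _ _ hd,
    latSum, latSum, ← ENNReal.tsum_add]
  refine tsum_congr fun m => ?_
  have e1 := h1 m
  have e2 := h2 m
  have e3 := h3 m
  have hm1 := hαr (toR2 m - x)
  have hm2 := hβr (toR2 m - x)
  simp only [Set.indicator_apply, Set.mem_ofPred_eq, Set.mem_Ico, toR2_sub q p, toR2_sub r p]
  change (if 0 ≤ α (toR2 m - x) ∧ 0 ≤ β (toR2 m - x) ∧ α (toR2 m - x) + β (toR2 m - x) ≤ 1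
      then (1 : ENNReal) else 0) +
    (if 0 ≤ α (toR2 (q + r) - (toR2 m - x)) ∧ 0 ≤ β (toR2 (q + r) - (toR2 m - x)) ∧
      α (toR2 (q + r) - (toR2 m - x)) + β (toR2 (q + r) - (toR2 m - x)) ≤ 1
      then (1 : ENNReal) else 0) =
    if (0 ≤ α (toR2 m - x) ∧ α (toR2 m - x) < 1) ∧ (0 ≤ β (toR2 m - x) ∧ β (toR2 m - x) < 1)
      then (1 : ENNReal) else 0
  rw [hm1, hm2]
  generalize α (toR2 m - x) = a at *
  generalize β (toR2 m - x) = b at *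
  rcases lt_or_gt_of_ne e3 with h | h
  · rw [if_neg (c := 0 ≤ 1 - a ∧ 0 ≤ 1 - b ∧ 1 - a + (1 - b) ≤ 1) (by
      rintro ⟨_, _, _⟩; linarith), add_zero]
    refine if_congr ?_ rfl rfl
    constructor
    · rintro ⟨ha, hb, -⟩
      exact ⟨⟨ha, by linarith⟩, hb, by linarith⟩
    · rintro ⟨⟨ha, -⟩, hb, -⟩
      exact ⟨ha, hb, h.le⟩
  · rw [if_neg (c := 0 ≤ a ∧ 0 ≤ b ∧ a + b ≤ 1) (by
      rintro ⟨_, _, _⟩; linarith), zero_add]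
    refine if_congr ?_ rfl rfl
    constructor
    · rintro ⟨ha, hb, -⟩
      have ha' : a < 1 := lt_of_le_of_ne (by linarith) e1
      have hb' : b < 1 := lt_of_le_of_ne (by linarith) e2
      exact ⟨⟨by linarith, ha'⟩, by linarith, hb'⟩
    · rintro ⟨⟨ha, ha'⟩, hb, hb'⟩
      exact ⟨by linarith, by linarith, by linarith⟩

theorem rcross_eq_zero_iff {u : ℝ × ℝ} (hu : u ≠ 0) {y : ℝ × ℝ} :
    rcross u y = 0 ↔ ∃ t : ℝ, y = t • u := by
  constructor
  · intro h
    simp only [rcross] at h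
    by_cases h1 : u.1 = 0
    · have h2 : u.2 ≠ 0 := fun h2 => hu (Prod.ext h1 h2)
      have hy : y.1 = 0 := by
        rw [h1, zero_mul, zero_sub, neg_eq_zero] at h
        exact (mul_eq_zero.1 h).resolve_left h2
      exact ⟨y.2 / u.2, Prod.ext (by simp [h1, hy]) (by simp [h2])⟩
    · refine ⟨y.1 / u.1, Prod.ext (by simp [h1]) ?_⟩
      simp only [Prod.smul_snd, smul_eq_mul]
      field_simp
      linarith
  · rintro ⟨t, rfl⟩
    simp only [rcross, Prod.smul_fst, Prod.smul_snd, smul_eq_mul]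
    ring

theorem le_one_of_mem_convexHull {E : Type*} [AddCommGroup E] [Module ℝ E] {S : Set E} {b d : E}
    (hb : b ∈ S) (hd : d ∈ S) (hbd : b ≠ d) (hdS : d ∉ convexHull ℝ (S \ {d})) {t : ℝ}
    (ht : b + t • (d - b) ∈ convexHull ℝ S) : t ≤ 1 := by
  by_contra! h
  have hb' : b ∈ S \ {d} := ⟨hb, hbd⟩
  rw [← Set.insert_sdiff_self_of_mem hd, convexHull_insert ⟨b, hb'⟩, mem_convexJoin] at ht
  obtain ⟨d', hd', q, hq, l, k, hl, hk, hlk, h1⟩ := ht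
  rw [Set.mem_singleton_iff.1 hd'] at h1
  refine hdS ?_
  have hpos : 0 < t - l := by linarith
  have hdq : d = ((t - 1) / (t - l)) • b + (k / (t - l)) • q := by
    have h2 : k • q = b + t • (d - b) - l • d := by rw [← h1]; abel
    rw [div_eq_inv_mul, div_eq_inv_mul, mul_smul, mul_smul, ← smul_add, h2, eq_inv_smul_iff₀ hpos.ne']
    module
  have hsum : (t - 1) / (t - l) + k / (t - l) = 1 := by
    rw [← add_div, div_eq_one_iff_eq hpos.ne']
    linarith
  have hmem : ((t - 1) / (t - l)) • b + (k / (t - l)) • q ∈ convexHull ℝ (S \ {d}) :=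
    convex_convexHull ℝ _ (subset_convexHull ℝ _ hb') hq (by apply div_nonneg <;> linarith)
      (by apply div_nonneg <;> linarith) hsum
  rwa [← hdq] at hmem

theorem mem_segment_of_rcross_eq_zero {S : Set (ℝ × ℝ)} (hS : ∀ s ∈ S, s ∉ convexHull ℝ (S \ {s}))
    {b d : ℝ × ℝ} (hb : b ∈ S) (hd : d ∈ S) (hbd : b ≠ d) {w : ℝ × ℝ} (hw : w ∈ convexHull ℝ S)
    (h : rcross (d - b) (w - b) = 0) : w ∈ segment ℝ b d := by
  obtain ⟨t, ht⟩ := (rcross_eq_zero_iff (sub_ne_zero.2 hbd.symm)).1 h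
  have hw1 : w = b + t • (d - b) := by rw [← ht]; abel
  have hw2 : w = d + (1 - t) • (b - d) := by rw [hw1]; module
  have h1 := le_one_of_mem_convexHull hb hd hbd (hS d hd) (hw1 ▸ hw)
  have h2 := le_one_of_mem_convexHull hd hb hbd.symm (hS b hb) (hw2 ▸ hw)
  exact ⟨1 - t, t, by linarith, by linarith, by ring, by rw [hw1]; module⟩

theorem rcross_ne_zero_of_notMem_convexHull {S : Set (ℝ × ℝ)}
    (hS : ∀ s ∈ S, s ∉ convexHull ℝ (S \ {s})) {p q r : ℝ × ℝ} (hp : p ∈ S) (hq : q ∈ S)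
    (hr : r ∈ S) (hpq : p ≠ q) (hpr : p ≠ r) (hqr : q ≠ r) : rcross (q - p) (r - p) ≠ 0 := by
  intro h
  have hseg := mem_segment_of_rcross_eq_zero hS hp hq hpq (subset_convexHull ℝ _ hr) h
  rw [← convexHull_pair] at hseg
  refine hS r hr (convexHull_mono ?_ hseg)
  rintro _ (rfl | rfl)
  exacts [⟨hp, hpr⟩, ⟨hq, hqr⟩]

theorem rcross_add_sub {u c y z : ℝ × ℝ} {s t : ℝ} (hst : s + t = 1) :
    rcross u (s • y + t • z - c) = s * rcross u (y - c) + t * rcross u (z - c) := by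
  obtain rfl : t = 1 - s := by linarith
  simp only [rcross, Prod.fst_add, Prod.snd_add, Prod.smul_fst, Prod.smul_snd,
    smul_eq_mul, Prod.fst_sub, Prod.snd_sub]
  ring

theorem convex_rcross_nonneg (u c : ℝ × ℝ) : Convex ℝ {y | 0 ≤ rcross u (y - c)} := by
  intro y hy z hz s t hs ht hst
  simp only [Set.mem_ofPred_eq] at *
  rw [rcross_add_sub hst]
  positivity

theorem convex_rcross_nonpos (u c : ℝ × ℝ) : Convex ℝ {y | rcross u (y - c) ≤ 0} := by
  intro y hy z hz s t hs ht hst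
  simp only [Set.mem_ofPred_eq] at *
  rw [rcross_add_sub hst]
  nlinarith

/-- Cutting the hull of a convexly independent set along a diagonal. -/
theorem mem_convexHull_of_rcross_nonneg {S : Set (ℝ × ℝ)}
    (hS : ∀ s ∈ S, s ∉ convexHull ℝ (S \ {s})) {b d : ℝ × ℝ} (hb : b ∈ S) (hd : d ∈ S)
    (hbd : b ≠ d) {x : ℝ × ℝ} (hx : x ∈ convexHull ℝ S) (h : 0 ≤ rcross (d - b) (x - b)) :
    x ∈ convexHull ℝ {s ∈ S | 0 ≤ rcross (d - b) (s - b)} := by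
  have hb0 : rcross (d - b) (b - b) = 0 := by simp [rcross]
  have hd0 : rcross (d - b) (d - b) = 0 := by simp only [rcross]; ring
  have hseg : segment ℝ b d ⊆ convexHull ℝ {s ∈ S | 0 ≤ rcross (d - b) (s - b)} :=
    (convex_convexHull ℝ _).segment_subset (subset_convexHull ℝ _ ⟨hb, hb0.ge⟩)
      (subset_convexHull ℝ _ ⟨hd, hd0.ge⟩)
  have hU : S = {s ∈ S | 0 ≤ rcross (d - b) (s - b)} ∪ {s ∈ S | rcross (d - b) (s - b) ≤ 0} := by
    ext s
    have := le_total 0 (rcross (d - b) (s - b))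
    simp only [Set.mem_union, Set.mem_ofPred_eq]
    tauto
  have hx' := hx
  have hne₁ : {s ∈ S | 0 ≤ rcross (d - b) (s - b)}.Nonempty := ⟨b, hb, hb0.ge⟩
  have hne₂ : {s ∈ S | rcross (d - b) (s - b) ≤ 0}.Nonempty := ⟨b, hb, hb0.le⟩
  rw [hU, convexHull_union hne₁ hne₂, mem_convexJoin] at hx'
  obtain ⟨y, hy, z, hz, s, t, hs, ht, hst, rfl⟩ := hx'
  have hy0 : 0 ≤ rcross (d - b) (y - b) :=
    convexHull_min (fun _ h => h.2) (convex_rcross_nonneg (d - b) b) hy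
  have hz0 : rcross (d - b) (z - b) ≤ 0 :=
    convexHull_min (fun _ h => h.2) (convex_rcross_nonpos (d - b) b) hz
  have hyS : y ∈ convexHull ℝ S := convexHull_mono (fun _ h => h.1) hy
  have hzS : z ∈ convexHull ℝ S := convexHull_mono (fun _ h => h.1) hz
  have hxe := rcross_add_sub (u := d - b) (c := b) (y := y) (z := z) hst
  rw [hxe] at h
  rcases hy0.eq_or_lt with hy1 | hy1
  · have h0 : rcross (d - b) (s • y + t • z - b) = 0 := by rw [hxe]; nlinarith
    exact hseg (mem_segment_of_rcross_eq_zero hS hb hd hbd hx h0)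
  · set Y := rcross (d - b) (y - b)
    set Z := rcross (d - b) (z - b)
    have hYZ : 0 < Y - Z := by linarith
    have hsum : -Z / (Y - Z) + Y / (Y - Z) = 1 := by field_simp; ring
    have hwS : (-Z / (Y - Z)) • y + (Y / (Y - Z)) • z ∈ convexHull ℝ S :=
      convex_convexHull ℝ _ hyS hzS (by apply div_nonneg <;> linarith)
        (by apply div_nonneg <;> linarith) hsum
    have hw := hseg (mem_segment_of_rcross_eq_zero hS hb hd hbd hwS (by
      rw [rcross_add_sub hsum]
      change -Z / (Y - Z) * Y + Y / (Y - Z) * Z = 0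
      ring))
    have hk : t * (Y - Z) / Y ≤ 1 := by
      rw [div_le_one hy1]
      nlinarith
    have hmem := convex_convexHull ℝ _ hy hw (a := 1 - t * (Y - Z) / Y) (b := t * (Y - Z) / Y)
      (by linarith) (by positivity) (by ring)
    convert hmem using 1
    obtain rfl : s = 1 - t := by linarith
    rw [smul_add, smul_smul, smul_smul, ← add_assoc, ← add_smul]
    congr 2
    · field_simp; ring
    · field_simp

theorem volume_convexHull_eq_zero {S : Set (ℝ × ℝ)} {u b : ℝ × ℝ} (hu : u ≠ 0)
    (h : ∀ s ∈ S, rcross u (s - b) = 0) : volume (convexHull ℝ S) = 0 := by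
  refine measure_mono_null (fun y hy => ?_) (volume_line_eq_zero hu (rcross u b))
  have h1 : 0 ≤ rcross u (y - b) :=
    convexHull_min (fun s hs => (h s hs).ge) (convex_rcross_nonneg u b) hy
  have h2 : rcross u (y - b) ≤ 0 :=
    convexHull_min (fun s hs => (h s hs).le) (convex_rcross_nonpos u b) hy
  simp only [rcross, Set.mem_ofPred_eq, Prod.fst_sub, Prod.snd_sub] at *
  linarith

/-- Among the lines joining `p` to three other points, one separates the remaining two. -/
theorem exists_diagonal {p q r s : ℝ × ℝ} (h1 : rcross (q - p) (r - p) ≠ 0)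
    (h2 : rcross (q - p) (s - p) ≠ 0) (h3 : rcross (r - p) (s - p) ≠ 0) :
    ∃ d ∈ ({q, r, s} : Set (ℝ × ℝ)), ∃ e ∈ ({q, r, s} : Set (ℝ × ℝ)),
      ∃ f ∈ ({q, r, s} : Set (ℝ × ℝ)), 0 < rcross (d - p) (e - p) ∧ rcross (d - p) (f - p) < 0 := by
  have anti : ∀ u v : ℝ × ℝ, rcross u v = -rcross v u := fun u v => by simp only [rcross]; ring
  have a1 := anti (r - p) (q - p)
  have a2 := anti (s - p) (q - p)
  have a3 := anti (s - p) (r - p)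
  have mq : q ∈ ({q, r, s} : Set (ℝ × ℝ)) := by simp
  have mr : r ∈ ({q, r, s} : Set (ℝ × ℝ)) := by simp
  have ms : s ∈ ({q, r, s} : Set (ℝ × ℝ)) := by simp
  rcases lt_or_gt_of_ne h1 with k1 | k1 <;> rcases lt_or_gt_of_ne h2 with k2 | k2 <;>
    rcases lt_or_gt_of_ne h3 with k3 | k3
  · exact ⟨r, mr, q, mq, s, ms, by linarith, by linarith⟩
  · exact ⟨s, ms, q, mq, r, mr, by linarith, by linarith⟩
  · exact ⟨q, mq, s, ms, r, mr, by linarith, by linarith⟩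
  · exact ⟨q, mq, s, ms, r, mr, by linarith, by linarith⟩
  · exact ⟨q, mq, r, mr, s, ms, by linarith, by linarith⟩
  · exact ⟨q, mq, r, mr, s, ms, by linarith, by linarith⟩
  · exact ⟨s, ms, r, mr, q, mq, by linarith, by linarith⟩
  · exact ⟨r, mr, s, ms, q, mq, by linarith, by linarith⟩

open Classical in
theorem hasConstSymmSum_convexHull (S : Finset (ℝ × ℝ)) (hZ : ∀ s ∈ S, ∃ m, toR2 m = s) :
    HasConstSymmSum (convexHull ℝ (S : Set (ℝ × ℝ))) := by
  induction S using Finset.strongInduction with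
  | H S ih =>
  by_cases hS : ∀ s ∈ (S : Set (ℝ × ℝ)), s ∉ convexHull ℝ ((S : Set (ℝ × ℝ)) \ {s})
  swap
  · push Not at hS
    obtain ⟨s, hs, hsS⟩ := hS
    have h := ih (S.erase s) (Finset.erase_ssubset hs) fun r hr => hZ r (Finset.mem_of_mem_erase hr)
    rw [Finset.coe_erase] at h
    convert h using 1
    refine (convexHull_min (fun r hr => ?_) (convex_convexHull ℝ _)).antisymm
      (convexHull_mono Set.sdiff_subset)
    by_cases hrs : r = s
    · exact hrs ▸ hsS
    · exact subset_convexHull ℝ _ ⟨hr, hrs⟩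
  rcases lt_or_ge 3 S.card with h3 | h3
  · obtain ⟨p, hp, q, hq, r, hr, s, hs, hpq, hpr, hps, hqr, hqs, hrs⟩ := Finset.three_lt_card.1 h3
    obtain ⟨d, hd, e, he, f, hf, h1, h2⟩ := exists_diagonal
      (rcross_ne_zero_of_notMem_convexHull hS hp hq hr hpq hpr hqr)
      (rcross_ne_zero_of_notMem_convexHull hS hp hq hs hpq hps hqs)
      (rcross_ne_zero_of_notMem_convexHull hS hp hr hs hpr hps hrs)
    have hmem : ∀ x ∈ ({q, r, s} : Set (ℝ × ℝ)), x ∈ S := by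
      rintro x (rfl | rfl | rfl) <;> assumption
    have hpd : p ≠ d := by rintro rfl; simp [rcross] at h1
    have hswap : ∀ x, rcross (p - d) (x - d) = -rcross (d - p) (x - p) := fun x => by
      simp only [rcross, Prod.fst_sub, Prod.snd_sub]; ring
    set A := S.filter fun x => 0 ≤ rcross (d - p) (x - p)
    set B := S.filter fun x => 0 ≤ rcross (p - d) (x - d)
    have hA := ih A (Finset.filter_ssubset.2 ⟨f, hmem f hf, h2.not_ge⟩)
      fun x hx => hZ x (Finset.mem_filter.1 hx).1
    have hB := ih B (Finset.filter_ssubset.2 ⟨e, hmem e he, by rw [hswap]; linarith⟩)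
      fun x hx => hZ x (Finset.mem_filter.1 hx).1
    have hU : convexHull ℝ (S : Set (ℝ × ℝ)) =
        convexHull ℝ (A : Set (ℝ × ℝ)) ∪ convexHull ℝ (B : Set (ℝ × ℝ)) := by
      refine Set.Subset.antisymm (fun x hx => ?_) (Set.union_subset (convexHull_mono ?_)
        (convexHull_mono ?_))
      · rcases le_total 0 (rcross (d - p) (x - p)) with h | h
        · left
          rw [Finset.coe_filter]
          exact mem_convexHull_of_rcross_nonneg hS hp (hmem d hd) hpd hx h
        · right
          rw [Finset.coe_filter]
          exact mem_convexHull_of_rcross_nonneg hS (hmem d hd) hp hpd.symm hx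
            (by rw [hswap]; linarith)
      · exact Finset.coe_subset.2 (Finset.filter_subset _ _)
      · exact Finset.coe_subset.2 (Finset.filter_subset _ _)
    rw [hU]
    refine hA.union hB (measure_mono_null (fun y hy => ?_)
      (volume_line_eq_zero (sub_ne_zero.2 hpd.symm) (rcross (d - p) p)))
    have k1 : 0 ≤ rcross (d - p) (y - p) :=
      convexHull_min (fun s hs => (Finset.mem_filter.1 hs).2) (convex_rcross_nonneg _ _) hy.1
    have k2 : 0 ≤ rcross (p - d) (y - d) :=
      convexHull_min (fun s hs => (Finset.mem_filter.1 hs).2) (convex_rcross_nonneg _ _) hy.2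
    rw [hswap] at k2
    simp only [rcross, Set.mem_ofPred_eq, Prod.fst_sub, Prod.snd_sub] at *
    linarith
  · have hcases : S.card = 0 ∨ S.card = 1 ∨ S.card = 2 ∨ S.card = 3 := by omega
    rcases hcases with h | h | h | h
    · rw [Finset.card_eq_zero.1 h]
      exact hasConstSymmSum_of_null (by simp)
    · obtain ⟨p, rfl⟩ := Finset.card_eq_one.1 h
      exact hasConstSymmSum_of_null (by simp)
    · obtain ⟨p, q, hpq, rfl⟩ := Finset.card_eq_two.1 h
      refine hasConstSymmSum_of_null
        (volume_convexHull_eq_zero (sub_ne_zero.2 hpq.symm) (b := p) fun s hs => ?_)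
      rw [Finset.coe_pair] at hs
      rcases hs with rfl | rfl <;> simp only [rcross, Prod.fst_sub, Prod.snd_sub] <;> ring
    · obtain ⟨p, q, r, hpq, hpr, hqr, rfl⟩ := Finset.card_eq_three.1 h
      have hd := rcross_ne_zero_of_notMem_convexHull hS (by simp) (by simp) (by simp) hpq hpr hqr
      obtain ⟨p, rfl⟩ := hZ p (by simp)
      obtain ⟨q, rfl⟩ := hZ q (by simp)
      obtain ⟨r, rfl⟩ := hZ r (by simp)
      simpa using hasConstSymmSum_triangle p q r hd

theorem ceil_eq_of_sub_mem_Ico {m : ℤ} {y : ℝ} (h : (m : ℝ) - y ∈ Set.Ico (0 : ℝ) 1) :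
    m = ⌈y⌉ := by
  rw [eq_comm, Int.ceil_eq_iff]
  exact ⟨by linarith [h.2], by linarith [h.1]⟩

theorem lintegral_latSum {A : Set (ℝ × ℝ)} (hA : MeasurableSet A) :
    ∫⁻ x in Set.Ico (0 : ℝ) 1 ×ˢ Set.Ico (0 : ℝ) 1, latSum A x = volume A := by
  set Q : Set (ℝ × ℝ) := Set.Ico (0 : ℝ) 1 ×ˢ Set.Ico (0 : ℝ) 1 with hQ
  have hQm : MeasurableSet Q := measurableSet_Ico.prod measurableSet_Ico
  have hsub : ∀ m : ℤ × ℤ, Measurable fun x : ℝ × ℝ => toR2 m - x := fun m => by fun_prop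
  have hind : Measurable (A.indicator (1 : ℝ × ℝ → ENNReal)) := measurable_one.indicator hA
  have hmeas : ∀ m : ℤ × ℤ, MeasurableSet ((fun x => toR2 m - x) ⁻¹' Q) := fun m => hsub m hQm
  calc ∫⁻ x in Q, latSum A x
      = ∑' m : ℤ × ℤ, ∫⁻ x in Q, A.indicator 1 (toR2 m - x) :=
        lintegral_tsum fun m => (hind.comp (hsub m)).aemeasurable
    _ = ∑' m : ℤ × ℤ, ∫⁻ y in (fun x => toR2 m - x) ⁻¹' Q, A.indicator 1 y := by
        refine tsum_congr fun m => ?_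
        rw [← (Measure.measurePreserving_sub_left volume (toR2 m)).setLIntegral_comp_preimage (hmeas m) hind]
        congr 2
        ext x
        simp
    _ = ∫⁻ y in ⋃ m : ℤ × ℤ, (fun x => toR2 m - x) ⁻¹' Q, A.indicator 1 y := by
        refine (lintegral_iUnion hmeas (fun m k hmk => Set.disjoint_left.2 fun y hm hk => ?_) _).symm
        refine hmk (Prod.ext ?_ ?_)
        · rw [ceil_eq_of_sub_mem_Ico hm.1, ceil_eq_of_sub_mem_Ico hk.1]
        · rw [ceil_eq_of_sub_mem_Ico hm.2, ceil_eq_of_sub_mem_Ico hk.2]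
    _ = volume A := by
        have hU : (⋃ m : ℤ × ℤ, (fun x => toR2 m - x) ⁻¹' Q) = Set.univ := by
          refine Set.eq_univ_of_forall fun y => Set.mem_iUnion.2 ⟨(⌈y.1⌉, ⌈y.2⌉), ?_⟩
          have h1 := Int.le_ceil y.1
          have h2 := Int.le_ceil y.2
          have h3 := Int.ceil_lt_add_one y.1
          have h4 := Int.ceil_lt_add_one y.2
          refine ⟨⟨?_, ?_⟩, ?_, ?_⟩ <;> simp only [toR2, Prod.fst_sub, Prod.snd_sub] <;> linarith
        rw [hU, Measure.restrict_univ, lintegral_indicator_one hA]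

theorem exists_toR2_eq_of_symm {S : Set (ℝ × ℝ)} (hS : S.Finite) (hne : S.Nonempty)
    (hZ : ∀ s ∈ S, ∃ m, toR2 m = s) {t : ℝ × ℝ}
    (ht : ∀ y, t - y ∈ convexHull ℝ S ↔ y ∈ convexHull ℝ S) : ∃ k, toR2 k = t := by
  obtain ⟨e, he⟩ := (hS.isCompact_convexHull ℝ).extremePoints_nonempty (hne.convexHull (𝕜 := ℝ))
  have he' : t - e ∈ (convexHull ℝ S).extremePoints ℝ := by
    refine mem_extremePoints_iff_left.2 ⟨(ht e).2 he.1, fun y hy z hz hyz => ?_⟩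
    have h := (mem_extremePoints_iff_left.1 he).2 (t - y) ((ht y).2 hy) (t - z) ((ht z).2 hz) (by
      obtain ⟨a, b, ha, hb, hab, h⟩ := hyz
      refine ⟨a, b, ha, hb, hab, ?_⟩
      have h2 : a • (t - y) + b • (t - z) = (a + b) • t - (a • y + b • z) := by module
      rw [h2, hab, h, one_smul, sub_sub_cancel])
    rw [← h, sub_sub_cancel]
  obtain ⟨m, hm⟩ := hZ _ (extremePoints_convexHull_subset he)
  obtain ⟨k, hk⟩ := hZ _ (extremePoints_convexHull_subset he')
  exact ⟨k + m, by rw [toR2_add, hm, hk, sub_add_cancel]⟩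

/-- If an integer polygon `P` is centrally symmetric (a translate of `-P`),
then `X_P` is almost surely constant, equal to the area of `P`. -/
theorem latCount_centrally_symmetric_const (n : ℕ) (a : Fin (n + 3) → ℤ × ℤ)
    (hccw : ∀ i : Fin (n + 3), 0 < zcross (a (i + 1) - a i) (a (i + 2) - a (i + 1)))
    (P : Set (ℝ × ℝ)) (hP : P = convexHull ℝ (Set.range fun i => toR2 (a i)))
    (hsym : ∃ t : ℝ × ℝ, P = (fun p => t - p) '' P) :
    ∀ᵐ x ∂μunit, (latCount P x : ℝ) = (volume P).toReal := by
  obtain ⟨t, ht⟩ := hsym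
  have hfin : (Set.range fun i => toR2 (a i)).Finite := Set.finite_range _
  have hZ : ∀ s ∈ Set.range fun i => toR2 (a i), ∃ m, toR2 m = s := by
    rintro _ ⟨i, rfl⟩
    exact ⟨_, rfl⟩
  have htP : ∀ y, t - y ∈ P ↔ y ∈ P := fun y => by
    constructor
    · intro h
      rw [ht]
      exact ⟨t - y, h, sub_sub_cancel t y⟩
    · intro h
      rw [ht]
      exact ⟨y, h, rfl⟩
  obtain ⟨k, rfl⟩ := exists_toR2_eq_of_symm hfin (Set.range_nonempty _) hZ (hP ▸ htP)
  have hcomp : IsCompact P := hP ▸ hfin.isCompact_convexHull ℝ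
  have hneg : ∀ x, latSum P (-x) = latSum P x := fun x => by
    rw [latSum_neg P k, latSum]
    refine tsum_congr fun m => ?_
    classical
    simp only [Set.indicator_apply, htP, Pi.one_apply]
  obtain ⟨c, hc⟩ : HasConstSymmSum P := by
    have h := hasConstSymmSum_convexHull hfin.toFinset fun s hs => hZ s (hfin.mem_toFinset.1 hs)
    rwa [hfin.coe_toFinset, ← hP] at h
  have hconst : ∀ᵐ x : ℝ × ℝ, latSum P x = c / 2 := by
    filter_upwards [hc] with x hx
    rw [hneg, ← mul_two] at hx
    rw [← hx, ENNReal.mul_div_cancel_right two_ne_zero ENNReal.ofNat_ne_top]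
  have hvol : volume P = c / 2 := by
    rw [← lintegral_latSum hcomp.measurableSet, lintegral_congr_ae (ae_restrict_of_ae hconst),
      lintegral_const, Measure.restrict_apply_univ, Measure.volume_eq_prod, Measure.prod_prod]
    simp
  refine ae_restrict_of_ae ?_
  filter_upwards [hconst] with x hx
  rw [← hvol, latSum_eq_encard] at hx
  rw [← hx, latCount, Set.ncard]
  generalize Set.encard _ = N
  cases N <;> simp
end
end

section
/- Let A, B ⊆ ℝ^d be compact sets. Then cov(X_A, X_B) = Σ_{m ∈ ℤ^d \ {0}} ĉ_A(m) · ĉ_B(−m), where ĉ_C(m) = ∫_C e^{−2πi⟨m,t⟩} dt is the Fourier transform of the indicator function of C, the series converging absolutely, and X_A, X_B are evaluated at the same uniform random point X ∈ [0,1]^d. -/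
open MeasureTheory

noncomputable section

/-- `latCountD C x = |(C + x) ∩ ℤ^d|`. -/
def latCountD (d : ℕ) (C : Set (Fin d → ℝ)) (x : Fin d → ℝ) : ℕ :=
  Set.ncard {m : Fin d → ℤ | ((fun i => (m i : ℝ)) - x) ∈ C}

/-- The uniform distribution on the unit cube `[0,1]^d`. -/
def μcube (d : ℕ) : Measure (Fin d → ℝ) := volume.restrict (Set.Icc 0 1)

/-- The Fourier transform of the indicator function of `C` at the frequency `m ∈ ℤ^d`:
`ĉ_C(m) = ∫_C e^{-2πi⟨m,t⟩} dt`. -/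
def ftInd (d : ℕ) (C : Set (Fin d → ℝ)) (m : Fin d → ℤ) : ℂ :=
  ∫ t in C, Complex.exp (-2 * Real.pi * Complex.I * ((∑ i, (m i : ℝ) * t i : ℝ) : ℂ))

/-- The half-open unit cube `(0,1]^d`. -/
def unitBoxIoc (d : ℕ) : Set (Fin d → ℝ) := Set.univ.pi fun _ => Set.Ioc 0 1

lemma measurableSet_unitBoxIoc (d : ℕ) : MeasurableSet (unitBoxIoc d) :=
  MeasurableSet.univ_pi fun _ => measurableSet_Ioc

lemma unitBoxIoc_subset_Icc (d : ℕ) : unitBoxIoc d ⊆ Set.Icc 0 1 := fun _ hx =>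
  ⟨fun i => (hx i trivial).1.le, fun i => (hx i trivial).2⟩

lemma μcube_eq_restrict_unitBoxIoc (d : ℕ) : μcube d = volume.restrict (unitBoxIoc d) :=
  (Measure.restrict_congr_set Measure.univ_pi_Ioc_ae_eq_Icc).symm

instance (d : ℕ) : IsProbabilityMeasure (μcube d) :=
  ⟨by simp [μcube, Real.volume_Icc_pi]⟩

/-- Unfolding an integral over `ℝ^d` into integrals over the reflected integer translates of the
half-open unit cube. -/
lemma hasSum_setIntegral_unitBoxIoc {d : ℕ} {f : (Fin d → ℝ) → ℂ} (hf : Integrable f) :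
    HasSum (fun m : Fin d → ℤ => ∫ x in unitBoxIoc d, f ((fun i => (m i : ℝ)) - x))
      (∫ t, f t) := by
  let s (m : Fin d → ℤ) : Set (Fin d → ℝ) :=
    (fun t => (fun i => (m i : ℝ)) - t) ⁻¹' unitBoxIoc d
  have hmem (m : Fin d → ℤ) (t : Fin d → ℝ) : t ∈ s m ↔ ∀ i, m i = ⌊t i⌋ + 1 := by
    simp only [s, unitBoxIoc, Set.mem_preimage, Set.mem_pi, Set.mem_univ, true_imp_iff,
      Set.mem_Ioc, Pi.sub_apply]
    refine forall_congr' fun i => ?_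
    rw [← sub_eq_iff_eq_add, eq_comm, Int.floor_eq_iff]
    push_cast
    constructor <;> rintro ⟨h₁, h₂⟩ <;> constructor <;> linarith
  have hcover : ⋃ m, s m = Set.univ :=
    Set.eq_univ_of_forall fun t => Set.mem_iUnion.2 ⟨fun i => ⌊t i⌋ + 1, (hmem _ _).2 fun _ => rfl⟩
  have hdisj : Pairwise (Function.onFun Disjoint s) := fun m n hmn =>
    Set.disjoint_left.2 fun t hm hn => hmn <| funext fun i =>
      ((hmem m t).1 hm i).trans ((hmem n t).1 hn i).symm
  have h := hasSum_integral_iUnion (μ := volume) (f := f) (s := s)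
    (fun m => (measurableSet_unitBoxIoc d).preimage (by fun_prop)) hdisj hf.integrableOn
  rw [hcover, setIntegral_univ] at h
  have hshift (m : Fin d → ℤ) :
      ∫ t in s m, f t = ∫ x in unitBoxIoc d, f ((fun i => (m i : ℝ)) - x) := by
    simpa only [sub_sub_cancel] using
      (Measure.measurePreserving_sub_left volume (fun i => (m i : ℝ))).setIntegral_preimage_emb
        (MeasurableEquiv.subLeft (fun i => (m i : ℝ))).measurableEmbedding
        (fun y => f ((fun i => (m i : ℝ)) - y)) (unitBoxIoc d)
  simpa only [hshift] using h

/-- Only finitely many integer points can be hit by translates of a compact set along the cube. -/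
lemma exists_finset_forall_sub_mem {d : ℕ} {C : Set (Fin d → ℝ)} (hC : IsCompact C) :
    ∃ S : Finset (Fin d → ℤ), ∀ x ∈ Set.Icc (0 : Fin d → ℝ) 1, ∀ m : Fin d → ℤ,
      (fun i => (m i : ℝ)) - x ∈ C → m ∈ S := by
  obtain ⟨R, hR⟩ := hC.isBounded.exists_norm_le
  refine ⟨Finset.Icc (fun _ => -⌈R⌉) (fun _ => ⌈R⌉ + 1), fun x hx m hm => ?_⟩
  have h (i : Fin d) : |(m i : ℝ) - x i| ≤ ⌈R⌉ :=
    ((norm_le_pi_norm _ i).trans (hR _ hm)).trans (Int.le_ceil R)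
  rw [Finset.mem_Icc]
  refine ⟨fun i => ?_, fun i => ?_⟩ <;> have h₁ := abs_le.1 (h i) <;>
    have h₂ := hx.1 i <;> have h₃ := hx.2 i <;> simp only [Pi.zero_apply, Pi.one_apply] at h₂ h₃
  · have : -(⌈R⌉ : ℝ) ≤ m i := by linarith
    exact_mod_cast this
  · have : (m i : ℝ) ≤ ⌈R⌉ + 1 := by linarith
    exact_mod_cast this

lemma latCountD_eq_sum_indicator {d : ℕ} {C : Set (Fin d → ℝ)} {S : Finset (Fin d → ℤ)}
    {x : Fin d → ℝ} (hS : ∀ m : Fin d → ℤ, (fun i => (m i : ℝ)) - x ∈ C → m ∈ S) :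
    (latCountD d C x : ℂ) = ∑ m ∈ S, C.indicator 1 ((fun i => (m i : ℝ)) - x) := by
  classical
  have h : {m : Fin d → ℤ | (fun i => (m i : ℝ)) - x ∈ C} =
      (S.filter fun m => (fun i => (m i : ℝ)) - x ∈ C : Finset (Fin d → ℤ)) := by
    ext m
    simpa using hS m
  rw [latCountD, h, Set.ncard_coe_finset, Finset.card_filter]
  simp [Set.indicator_apply]

/-- The Fourier coefficients of the lattice point count on the unit cube. -/
lemma setIntegral_exp_mul_latCountD {d : ℕ} {C : Set (Fin d → ℝ)} (hC : IsCompact C)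
    (n : Fin d → ℤ) :
    ∫ x in unitBoxIoc d,
      Complex.exp (2 * Real.pi * Complex.I * ((∑ i, (n i : ℝ) * x i : ℝ) : ℂ)) * latCountD d C x =
      ftInd d C n := by
  classical
  obtain ⟨S, hS⟩ := exists_finset_forall_sub_mem hC
  let e (t : Fin d → ℝ) : ℂ :=
    Complex.exp (-2 * Real.pi * Complex.I * ((∑ i, (n i : ℝ) * t i : ℝ) : ℂ))
  have he : Continuous e := by fun_prop
  have hint : Integrable (C.indicator e) :=
    (integrable_indicator_iff hC.measurableSet).2 (he.continuousOn.integrableOn_compact hC)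
  have hperiod (m : Fin d → ℤ) (x : Fin d → ℝ) : e ((fun i => (m i : ℝ)) - x) =
      Complex.exp (2 * Real.pi * Complex.I * ((∑ i, (n i : ℝ) * x i : ℝ) : ℂ)) := by
    refine Complex.exp_eq_exp_iff_exists_int.2 ⟨-∑ i, n i * m i, ?_⟩
    simp only [Pi.sub_apply, mul_sub, Finset.sum_sub_distrib]
    push_cast
    ring
  have hunfold := hasSum_setIntegral_unitBoxIoc hint
  have hzero (m : Fin d → ℤ) (hm : m ∉ S) :
      ∫ x in unitBoxIoc d, C.indicator e ((fun i => (m i : ℝ)) - x) = 0 :=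
    setIntegral_eq_zero_of_forall_eq_zero fun x hx =>
      Set.indicator_of_notMem (fun h => hm (hS x (unitBoxIoc_subset_Icc d hx) m h)) _
  rw [integral_indicator hC.measurableSet] at hunfold
  change _ = ∫ t in C, e t
  rw [hunfold.unique (hasSum_sum_of_ne_finset_zero fun m hm => hzero m hm),
    ← integral_finsetSum]
  · refine setIntegral_congr_fun (measurableSet_unitBoxIoc d) fun x hx => ?_
    rw [latCountD_eq_sum_indicator (hS x (unitBoxIoc_subset_Icc d hx)), Finset.mul_sum]
    refine Finset.sum_congr rfl fun m _ => ?_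
    simp only [Set.indicator_apply, hperiod, Pi.one_apply, mul_ite, mul_one, mul_zero]
  · exact fun m _ => (hint.comp_sub_left _).integrableOn

section Torus

attribute [local instance] instMeasureSpaceUnitAddCircle

local instance : IsProbabilityMeasure (volume : Measure UnitAddCircle) :=
  inferInstanceAs (IsProbabilityMeasure AddCircle.haarAddCircle)

/-- The lattice point count as a function on the torus. -/
def latCountTorus (d : ℕ) (C : Set (Fin d → ℝ)) (z : UnitAddTorus (Fin d)) : ℂ :=
  latCountD d C (UnitAddTorus.measurableEquivPiIoc 0 z).1

lemma measurableEquivPiIoc_mem_unitBoxIoc {d : ℕ} (z : UnitAddTorus (Fin d)) :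
    (UnitAddTorus.measurableEquivPiIoc (0 : Fin d → ℝ) z).1 ∈ unitBoxIoc d := fun i _ => by
  simpa using (UnitAddTorus.measurableEquivPiIoc (0 : Fin d → ℝ) z).2 i

lemma measurableEquivPiIoc_coe {d : ℕ} {x : Fin d → ℝ} (hx : x ∈ unitBoxIoc d) :
    (UnitAddTorus.measurableEquivPiIoc (0 : Fin d → ℝ) fun i => (x i : UnitAddCircle)).1 = x := by
  have hx' : ∀ i, x i ∈ Set.Ioc ((0 : Fin d → ℝ) i) ((0 : Fin d → ℝ) i + 1) := fun i => by
    simpa using hx i trivial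
  exact congrArg Subtype.val
    ((UnitAddTorus.measurableEquivPiIoc (0 : Fin d → ℝ)).apply_symm_apply ⟨x, hx'⟩)

lemma integral_torus_eq {d : ℕ} (f : UnitAddTorus (Fin d) → ℂ) :
    ∫ z, f z = ∫ x in unitBoxIoc d, f fun i => (x i : UnitAddCircle) := by
  rw [UnitAddTorus.integral_preimage f 0]
  congr! 2
  ext x
  simp [unitBoxIoc]

lemma latCountTorus_coe {d : ℕ} (C : Set (Fin d → ℝ)) {x : Fin d → ℝ} (hx : x ∈ unitBoxIoc d) :
    latCountTorus d C (fun i => (x i : UnitAddCircle)) = latCountD d C x := by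
  rw [latCountTorus, measurableEquivPiIoc_coe hx]

lemma memLp_latCountTorus {d : ℕ} {C : Set (Fin d → ℝ)} (hC : IsCompact C) (p : ENNReal) :
    MemLp (latCountTorus d C) p := by
  obtain ⟨S, hS⟩ := exists_finset_forall_sub_mem hC
  have heq : latCountTorus d C = fun z => ∑ m ∈ S, C.indicator 1
      ((fun i => (m i : ℝ)) - (UnitAddTorus.measurableEquivPiIoc (0 : Fin d → ℝ) z).1) :=
    funext fun z => latCountD_eq_sum_indicator
      (hS _ (unitBoxIoc_subset_Icc d (measurableEquivPiIoc_mem_unitBoxIoc z)))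
  rw [heq]
  refine memLp_finsetSum _ fun m _ => MemLp.of_bound (Measurable.aestronglyMeasurable ?_) 1
    (.of_forall fun z => ?_)
  · exact ((measurable_one (α := ℂ)).indicator hC.measurableSet).comp
      (measurable_const.sub (measurable_subtype_coe.comp (MeasurableEquiv.measurable _)))
  · exact (norm_indicator_le_norm_self _ _).trans (by simp)

lemma mFourierCoeff_latCountTorus {d : ℕ} {C : Set (Fin d → ℝ)} (hC : IsCompact C)
    (n : Fin d → ℤ) : UnitAddTorus.mFourierCoeff (latCountTorus d C) n = ftInd d C (-n) := by
  rw [UnitAddTorus.mFourierCoeff, integral_torus_eq, ← setIntegral_exp_mul_latCountD hC]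
  refine setIntegral_congr_fun (measurableSet_unitBoxIoc d) fun x hx => ?_
  simp only [latCountTorus_coe C hx, smul_eq_mul, UnitAddTorus.mFourier, ContinuousMap.coe_mk,
    fourier_coe_apply, ← Complex.exp_sum]
  congr 2
  push_cast
  rw [Finset.mul_sum]
  exact Finset.sum_congr rfl fun i _ => by simp; ring

lemma conj_ftInd {d : ℕ} (C : Set (Fin d → ℝ)) (n : Fin d → ℤ) :
    starRingEnd ℂ (ftInd d C n) = ftInd d C (-n) := by
  rw [ftInd, ftInd, ← integral_conj]
  refine integral_congr_ae (.of_forall fun t => ?_)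
  simp only [← Complex.exp_conj, map_mul, map_neg, map_ofNat, Complex.conj_ofReal, Complex.conj_I]
  congr 1
  simp

/-- Parseval's identity for the lattice point counts. -/
lemma hasSum_ftInd_mul_ftInd_neg {d : ℕ} {A B : Set (Fin d → ℝ)} (hA : IsCompact A)
    (hB : IsCompact B) :
    HasSum (fun m => ftInd d A m * ftInd d B (-m))
      ((∫ x, (latCountD d A x : ℝ) * latCountD d B x ∂μcube d : ℝ) : ℂ) := by
  have hFA := (memLp_latCountTorus hA 2).coeFn_toLp
  have hFB := (memLp_latCountTorus hB 2).coeFn_toLp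
  have hcoeff {C : Set (Fin d → ℝ)} (hC : IsCompact C) (n : Fin d → ℤ) :
      UnitAddTorus.mFourierCoeff ((memLp_latCountTorus hC 2).toLp _) n = ftInd d C (-n) := by
    rw [← mFourierCoeff_latCountTorus hC]
    refine integral_congr_ae ?_
    filter_upwards [(memLp_latCountTorus hC 2).coeFn_toLp] with z hz
    rw [hz]
  have h := UnitAddTorus.hasSum_prod_mFourierCoeff ((memLp_latCountTorus hA 2).toLp _)
    ((memLp_latCountTorus hB 2).toLp _)
  simp only [hcoeff hA, hcoeff hB, conj_ftInd, neg_neg] at h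
  convert h using 1
  rw [← integral_complex_ofReal, μcube_eq_restrict_unitBoxIoc]
  trans ∫ z, starRingEnd ℂ (latCountTorus d A z) * latCountTorus d B z
  · rw [integral_torus_eq]
    refine setIntegral_congr_fun (measurableSet_unitBoxIoc d) fun x hx => ?_
    simp [latCountTorus_coe _ hx]
  · refine integral_congr_ae ?_
    filter_upwards [hFA, hFB] with z hzA hzB
    rw [hzA, hzB]

end Torus

lemma integral_latCountD {d : ℕ} {C : Set (Fin d → ℝ)} (hC : IsCompact C) :
    ((∫ x, (latCountD d C x : ℝ) ∂μcube d : ℝ) : ℂ) = ftInd d C 0 := by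
  rw [← setIntegral_exp_mul_latCountD hC, ← integral_complex_ofReal, μcube_eq_restrict_unitBoxIoc]
  simp

lemma memLp_latCountD {d : ℕ} {C : Set (Fin d → ℝ)} (hC : IsCompact C) (p : ENNReal) :
    MemLp (fun x => (latCountD d C x : ℝ)) p (μcube d) := by
  obtain ⟨S, hS⟩ := exists_finset_forall_sub_mem hC
  have hsum : MemLp (fun x => ∑ m ∈ S, C.indicator (1 : (Fin d → ℝ) → ℂ)
      ((fun i => (m i : ℝ)) - x)) p (μcube d) := by
    refine memLp_finsetSum _ fun m _ => MemLp.of_bound (Measurable.aestronglyMeasurable ?_) 1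
      (.of_forall fun z => (norm_indicator_le_norm_self _ _).trans (by simp))
    exact ((measurable_one (α := ℂ)).indicator hC.measurableSet).comp (by fun_prop)
  refine hsum.re.ae_eq ?_
  filter_upwards [ae_restrict_mem (μ := volume) (measurableSet_Icc (a := (0 : Fin d → ℝ)) (b := 1))]
    with x hx
  rw [← latCountD_eq_sum_indicator (hS x hx)]
  simp

/-- For compact sets `A, B ⊆ ℝ^d`,
`cov(X_A, X_B) = ∑_{m ∈ ℤ^d \ {0}} ĉ_A(m)·ĉ_B(-m)`, the series converging absolutely,
where `X_A, X_B` use the same uniform point `X ∈ [0,1]^d`. -/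
theorem covariance_eq_tsum_fourier (d : ℕ) (A B : Set (Fin d → ℝ))
    (hA : IsCompact A) (hB : IsCompact B) :
    Summable (fun m : {m : Fin d → ℤ // m ≠ 0} => ‖ftInd d A m.1 * ftInd d B (-m.1)‖) ∧
    ((∫ x, ((latCountD d A x : ℝ) - ∫ y, (latCountD d A y : ℝ) ∂μcube d)
        * ((latCountD d B x : ℝ) - ∫ y, (latCountD d B y : ℝ) ∂μcube d) ∂μcube d : ℝ) : ℂ)
      = ∑' m : {m : Fin d → ℤ // m ≠ 0}, ftInd d A m.1 * ftInd d B (-m.1) := by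
  have hsum := hasSum_ftInd_mul_ftInd_neg hA hB
  refine ⟨(hsum.summable.subtype {m | m ≠ 0}).norm, ?_⟩
  have hsplit := hsum.summable.tsum_subtype_add_tsum_subtype_compl {m | m ≠ 0}
  have hcompl : {m : Fin d → ℤ | m ≠ 0}ᶜ = {0} := by ext; simp
  rw [hcompl, tsum_singleton (0 : Fin d → ℤ) (fun m => ftInd d A m * ftInd d B (-m)), hsum.tsum_eq, neg_zero, ← integral_latCountD hA,
    ← integral_latCountD hB] at hsplit
  have hcov := ProbabilityTheory.covariance_eq_sub (memLp_latCountD hA 2) (memLp_latCountD hB 2)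
  rw [ProbabilityTheory.covariance] at hcov
  rw [hcov]
  push_cast
  exact (eq_sub_of_add_eq hsplit).symm
end
end

section
/- Let A ⊆ ℝ^d be a compact set. Then Σ_{n ∈ ℤ^d} g_A(n) ≥ vol(A)², where g_A(x) = vol(A ∩ (A + x)) is the covariogram of A. -/
open MeasureTheory

open scoped ENNReal

/-- On a probability space, the square of an integral is at most the integral of the square. -/
lemma lintegral_sq_le_lintegral_sq {α : Type*} [MeasurableSpace α] (μ : Measure α)
    [IsProbabilityMeasure μ] {f : α → ℝ≥0∞} (hf : AEMeasurable f μ) :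
    (∫⁻ x, f x ∂μ) ^ 2 ≤ ∫⁻ x, f x ^ 2 ∂μ := by
  have h := ENNReal.lintegral_mul_le_Lp_mul_Lq μ Real.HolderConjugate.two_two hf
    (aemeasurable_const (b := (1 : ℝ≥0∞)))
  simp only [Pi.mul_apply, mul_one, ENNReal.rpow_two, one_pow, lintegral_one,
    measure_univ, ENNReal.one_rpow] at h
  calc (∫⁻ x, f x ∂μ) ^ 2 ≤ ((∫⁻ x, f x ^ 2 ∂μ) ^ (1 / 2 : ℝ)) ^ 2 := by gcongr
    _ = ∫⁻ x, f x ^ 2 ∂μ := by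
      rw [← ENNReal.rpow_natCast, ← ENNReal.rpow_mul]
      norm_num

/-- The canonical embedding of `ℤ^d` in `ℝ^d`. -/
def latticeCast {d : ℕ} (n : Fin d → ℤ) : Fin d → ℝ := fun i => (n i : ℝ)

lemma latticeCast_add {d : ℕ} (m n : Fin d → ℤ) :
    latticeCast (m + n) = latticeCast m + latticeCast n := by
  ext i; simp [latticeCast]

lemma latticeCast_neg {d : ℕ} (n : Fin d → ℤ) : latticeCast (-n) = -latticeCast n := by
  ext i; simp [latticeCast]

/-- The half-open unit cube in `ℝ^d`. -/
def unitCube (d : ℕ) : Set (Fin d → ℝ) := Set.univ.pi fun _ => Set.Ico 0 1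

lemma measurableSet_unitCube (d : ℕ) : MeasurableSet (unitCube d) :=
  MeasurableSet.univ_pi fun _ => measurableSet_Ico

lemma volume_unitCube (d : ℕ) : volume (unitCube d) = 1 := by
  simp [unitCube, volume_pi_pi]

lemma sub_latticeCast_mem_unitCube_iff {d : ℕ} (x : Fin d → ℝ) (n : Fin d → ℤ) :
    x - latticeCast n ∈ unitCube d ↔ (fun i => ⌊x i⌋) = n := by
  simp only [unitCube, latticeCast, Set.mem_univ_pi, Set.mem_Ico, Pi.sub_apply, funext_iff,
    Int.floor_eq_iff]
  refine forall_congr' fun i => ?_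
  constructor <;> rintro ⟨h₁, h₂⟩ <;> constructor <;> linarith

/-- An integral over `ℝ^d` is the integral over the unit cube of the periodization. -/
lemma lintegral_eq_setLIntegral_unitCube_tsum {d : ℕ} {f : (Fin d → ℝ) → ℝ≥0∞}
    (hf : Measurable f) :
    ∫⁻ x, f x = ∫⁻ x in unitCube d, ∑' n : Fin d → ℤ, f (x + latticeCast n) := by
  have hmeas (n : Fin d → ℤ) : MeasurableSet ((· - latticeCast n) ⁻¹' unitCube d) :=
    measurableSet_preimage (measurable_sub_const (latticeCast n)) (measurableSet_unitCube d)
  have hshift (n : Fin d → ℤ) : Measurable fun x => f (x + latticeCast n) :=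
    hf.comp (measurable_add_const (latticeCast n))
  have hcover : ⋃ n : Fin d → ℤ, (· - latticeCast n) ⁻¹' unitCube d = Set.univ := by
    refine Set.eq_univ_of_forall fun x => Set.mem_iUnion.2 ⟨fun i => ⌊x i⌋, ?_⟩
    exact (sub_latticeCast_mem_unitCube_iff x _).2 rfl
  have hdisj : Pairwise (Function.onFun Disjoint
      fun n : Fin d → ℤ => (· - latticeCast n) ⁻¹' unitCube d) := by
    refine fun m n hmn => Set.disjoint_left.2 fun x hm hn => hmn ?_
    exact ((sub_latticeCast_mem_unitCube_iff x m).1 hm).symm.trans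
      ((sub_latticeCast_mem_unitCube_iff x n).1 hn)
  rw [← setLIntegral_univ, ← hcover, lintegral_iUnion hmeas hdisj,
    lintegral_tsum fun n => (hshift n).aemeasurable]
  refine tsum_congr fun n => ?_
  rw [← lintegral_indicator (hmeas n), ← lintegral_indicator (measurableSet_unitCube d)]
  refine (lintegral_add_right_eq_self _ (latticeCast n)).symm.trans
    (lintegral_congr fun x => ?_)
  by_cases h : x ∈ unitCube d <;> simp [h]

/-- The lattice sum of the covariogram of a measurable set is at least its volume squared. -/
lemma volume_sq_le_tsum_volume_inter {d : ℕ} {A : Set (Fin d → ℝ)} (hA : MeasurableSet A) :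
    volume A ^ 2 ≤ ∑' n : Fin d → ℤ, volume (A ∩ (· + latticeCast n) ⁻¹' A) := by
  set χ : (Fin d → ℝ) → ℝ≥0∞ := A.indicator 1 with hχ
  have hχm : Measurable χ := measurable_one.indicator hA
  have hshift (n : Fin d → ℤ) : Measurable fun x => χ (x + latticeCast n) :=
    hχm.comp (measurable_add_const (latticeCast n))
  set N : (Fin d → ℝ) → ℝ≥0∞ := fun x => ∑' n : Fin d → ℤ, χ (x + latticeCast n) with hN
  have hNm : Measurable N := Measurable.tsum hshift
  have hperiodic (x : Fin d → ℝ) (m : Fin d → ℤ) : N (x + latticeCast m) = N x := by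
    simp only [hN]
    rw [← (Equiv.addLeft m).tsum_eq fun n => χ (x + latticeCast n)]
    simp [latticeCast_add, add_assoc]
  have : IsProbabilityMeasure (volume.restrict (unitCube d)) :=
    ⟨by simp [volume_unitCube]⟩
  calc volume A ^ 2 = (∫⁻ x in unitCube d, N x) ^ 2 := by
        rw [← lintegral_eq_setLIntegral_unitCube_tsum hχm, lintegral_indicator_one hA]
    _ ≤ ∫⁻ x in unitCube d, N x ^ 2 := lintegral_sq_le_lintegral_sq _ hNm.aemeasurable
    _ = ∫⁻ x, χ x * N x := by
        rw [lintegral_eq_setLIntegral_unitCube_tsum (f := fun x => χ x * N x) (hχm.mul hNm)]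
        refine lintegral_congr fun x => ?_
        simp only [hperiodic, ENNReal.tsum_mul_right, sq]
        rfl
    _ = ∑' n : Fin d → ℤ, ∫⁻ x, χ x * χ (x + latticeCast n) := by
        simp only [hN, ← ENNReal.tsum_mul_left]
        exact lintegral_tsum fun n => (hχm.mul (hshift n)).aemeasurable
    _ = ∑' n : Fin d → ℤ, volume (A ∩ (· + latticeCast n) ⁻¹' A) := by
        refine tsum_congr fun n => ?_
        rw [← lintegral_indicator_one
          (hA.inter (measurableSet_preimage (measurable_add_const (latticeCast n)) hA))]
        refine lintegral_congr fun x => ?_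
        by_cases h₁ : x ∈ A <;> by_cases h₂ : x + latticeCast n ∈ A <;> simp [hχ, h₁, h₂]

/-- A bounded set meets only finitely many of its lattice translates. -/
lemma finite_setOf_inter_translate_nonempty {d : ℕ} {A : Set (Fin d → ℝ)}
    (hA : Bornology.IsBounded A) :
    {n : Fin d → ℤ | (A ∩ (· + latticeCast n) '' A).Nonempty}.Finite := by
  obtain ⟨R, hR⟩ := hA.exists_norm_le
  refine (Set.finite_Icc (fun _ : Fin d => -⌈2 * R⌉) (fun _ => ⌈2 * R⌉)).subset ?_
  rintro n ⟨_, hx, y, hy, rfl⟩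
  have hbound (i : Fin d) : |(n i : ℝ)| ≤ (⌈2 * R⌉ : ℤ) := by
    have h₁ := (norm_le_pi_norm _ i).trans (hR _ hx)
    have h₂ := (norm_le_pi_norm _ i).trans (hR _ hy)
    simp only [Pi.add_apply, latticeCast, Real.norm_eq_abs, abs_le] at h₁ h₂
    refine le_trans ?_ (Int.le_ceil _)
    rw [abs_le]
    constructor <;> linarith
  have hbound' (i : Fin d) : |n i| ≤ ⌈2 * R⌉ := by exact_mod_cast hbound i
  exact ⟨fun i => (abs_le.1 (hbound' i)).1, fun i => (abs_le.1 (hbound' i)).2⟩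

/-- For a compact set `A ⊆ ℝ^d`,
`∑_{n ∈ ℤ^d} g_A(n) ≥ vol(A)²`, where `g_A(x) = vol(A ∩ (A + x))` is the covariogram. -/
theorem covariogram_lattice_sum_ge_volume_sq (d : ℕ) (A : Set (Fin d → ℝ))
    (hA : IsCompact A) :
    (volume A).toReal ^ 2
      ≤ ∑' n : Fin d → ℤ,
          (volume (A ∩ ((· + (fun i => (n i : ℝ))) '' A))).toReal := by
  change _ ≤ ∑' n : Fin d → ℤ, (volume (A ∩ (· + latticeCast n) '' A)).toReal
  have hfin (n : Fin d → ℤ) : volume (A ∩ (· + latticeCast n) '' A) ≠ ∞ :=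
    measure_ne_top_of_subset Set.inter_subset_left hA.measure_ne_top
  have hsum : ∑' n : Fin d → ℤ, volume (A ∩ (· + latticeCast n) '' A) ≠ ∞ := by
    have hsupp := finite_setOf_inter_translate_nonempty hA.isBounded
    rw [tsum_eq_sum (s := hsupp.toFinset)]
    · exact ENNReal.sum_ne_top.2 fun n _ => hfin n
    · intro n hn
      have hempty : A ∩ (· + latticeCast n) '' A = ∅ := by
        simpa [Set.not_nonempty_iff_eq_empty] using hn
      rw [hempty, measure_empty]
  rw [← ENNReal.tsum_toReal_eq hfin, ← ENNReal.toReal_pow]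
  refine ENNReal.toReal_mono hsum ((volume_sq_le_tsum_volume_inter hA.measurableSet).trans_eq ?_)
  rw [← (Equiv.neg (Fin d → ℤ)).tsum_eq]
  simp [latticeCast_neg, Set.image_add_right]
end
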